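/- Let T be a compactly generated R-linear triangulated category that is noetherian and stratified by R. For each localizing subcategory S of T, the left orthogonal subcategory ^⊥S = {X ∈ T | Hom*_T(X,Y) = 0 for all Y ∈ S} satisfies supp_R(^⊥S) = {p ∈ supp_R T | V(p) ∩ supp_R S = ∅}, where supp_R S = ∪_{X∈S} supp_R X. -/

import Mathlib

open CategoryTheory CategoryTheory.Limits CategoryTheory.Pretriangulated

universe w v u u'

namespace BIK

section RingDefs

variable {R : Type u} [Ring R] (𝒜 : ℤ → AddSubgroup R) [GradedRing 𝒜]

/-- `R` is graded-commutative: `a * b = (-1)^{|a||b|} b * a` for homogeneous `a`, `b`. -/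
def IsGradedComm : Prop :=
  ∀ (i j : ℤ) (a b : R), a ∈ 𝒜 i → b ∈ 𝒜 j →
    a * b = ((-1 : ℤ) ^ (i * j).natAbs) • (b * a)

/-- A homogeneous ideal is prime if it is proper and for homogeneous elements `a`, `b`,
`a * b ∈ P` implies `a ∈ P` or `b ∈ P`. -/
structure IsHomPrime (P : HomogeneousIdeal 𝒜) : Prop where
  ne_top : P.toIdeal ≠ ⊤
  mem_or_mem : ∀ {i j : ℤ} {a b : R}, a ∈ 𝒜 i → b ∈ 𝒜 j →
    a * b ∈ P.toIdeal → a ∈ P.toIdeal ∨ b ∈ P.toIdeal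

/-- `Spec R`: the set of homogeneous prime ideals of the graded ring `R`. -/
def SpecR : Type u := {P : HomogeneousIdeal 𝒜 // IsHomPrime 𝒜 P}

variable {𝒜}

/-- `V(𝔞)`, the set of homogeneous primes containing the ideal `𝔞`. -/
def specV (𝔞 : Ideal R) : Set (SpecR 𝒜) := {p | 𝔞 ≤ p.1.toIdeal}

/-- A subset of `Spec R` is specialization closed if with any point it contains all larger
primes. -/
def SpecClosed (V : Set (SpecR 𝒜)) : Prop :=
  ∀ p q : SpecR 𝒜, p ∈ V → p.1.toIdeal ≤ q.1.toIdeal → q ∈ V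

/-- `Z(p) = { q | q ⊄ p }`. -/
def Zset (p : SpecR 𝒜) : Set (SpecR 𝒜) := {q | ¬ q.1.toIdeal ≤ p.1.toIdeal}

/-- `V(p) = { q | q ⊇ p }`. -/
def Vp (p : SpecR 𝒜) : Set (SpecR 𝒜) := {q | p.1.toIdeal ≤ q.1.toIdeal}

/-- The specialization closure of a subset of `Spec R`. -/
def specCl (U : Set (SpecR 𝒜)) : Set (SpecR 𝒜) := {p | ∃ q ∈ U, q.1.toIdeal ≤ p.1.toIdeal}

/-- The subset `U ⊆ Spec R` has finite dimension: the lengths of strict chains of primes in `U`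
are bounded. -/
def FiniteDim (U : Set (SpecR 𝒜)) : Prop :=
  ∃ n : ℕ, ∀ (m : ℕ) (c : Fin (m + 1) → SpecR 𝒜), (∀ i, c i ∈ U) →
    (StrictMono fun i => (c i).1.toIdeal) → m ≤ n

end RingDefs

section CatDefs

variable (T : Type u') [Category.{v} T] [HasZeroObject T] [Preadditive T] [HasShift T ℤ]
  [∀ n : ℤ, (CategoryTheory.shiftFunctor T n).Additive] [Pretriangulated T]
  [HasCoproducts.{v} T]

/-- The canonical map `⨁ⱼ Hom(C, fⱼ) → Hom(C, ∐ f)`. -/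
noncomputable def sigmaHom (C : T) {J : Type v} (f : J → T) :
    (DirectSum J fun j => (C ⟶ f j)) →+ (C ⟶ ∐ f) :=
  letI := Classical.decEq J
  DirectSum.toAddMonoid fun j =>
    AddMonoidHom.mk' (fun g => g ≫ Sigma.ι f j) (fun g h => by simp)

/-- An object `C` is compact if `Hom(C, -)` commutes with arbitrary coproducts. -/
def IsCompactObj (C : T) : Prop :=
  ∀ (J : Type v) (f : J → T), Function.Bijective (sigmaHom T C f)

/-- A localizing subcategory: a (strictly full) triangulated subcategory closed under
arbitrary coproducts. -/
structure IsLocalizing (S : Set T) : Prop where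
  zero_mem : ∀ X : T, Limits.IsZero X → X ∈ S
  iso_mem : ∀ {X Y : T}, (X ≅ Y) → X ∈ S → Y ∈ S
  shift_mem : ∀ X ∈ S, ∀ n : ℤ, X⟦n⟧ ∈ S
  ext_mem : ∀ Tr ∈ distTriang T, Tr.obj₁ ∈ S → Tr.obj₂ ∈ S → Tr.obj₃ ∈ S
  coprod_mem : ∀ (J : Type v) (f : J → T), (∀ j, f j ∈ S) → (∐ f) ∈ S

/-- The localizing subcategory generated by a class of objects. -/
def Loc (A : Set T) : Set T := ⋂₀ {S | IsLocalizing T S ∧ A ⊆ S}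

/-- A thick subcategory: a (strictly full) triangulated subcategory closed under
direct summands (i.e. retracts). -/
structure IsThick (S : Set T) : Prop where
  zero_mem : ∀ X : T, Limits.IsZero X → X ∈ S
  iso_mem : ∀ {X Y : T}, (X ≅ Y) → X ∈ S → Y ∈ S
  shift_mem : ∀ X ∈ S, ∀ n : ℤ, X⟦n⟧ ∈ S
  ext_mem : ∀ Tr ∈ distTriang T, Tr.obj₁ ∈ S → Tr.obj₂ ∈ S → Tr.obj₃ ∈ S
  retract_mem : ∀ X Y : T, Y ∈ S → ∀ (i : X ⟶ Y) (p : Y ⟶ X), i ≫ p = 𝟙 X → X ∈ S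

/-- The thick subcategory generated by a class of objects. -/
def ThickSub (A : Set T) : Set T := ⋂₀ {S | IsThick T S ∧ A ⊆ S}

/-- `T` is compactly generated: it is generated, as a localizing subcategory,
by a set of compact objects. -/
def CompactlyGen : Prop :=
  ∃ (ι : Type v) (g : ι → T), (∀ i, IsCompactObj T (g i)) ∧ Loc T (Set.range g) = Set.univ

end CatDefs

section Action

variable {R : Type u} [Ring R] (𝒜 : ℤ → AddSubgroup R) [GradedRing 𝒜]
variable (T : Type u') [Category.{v} T] [HasZeroObject T] [Preadditive T] [HasShift T ℤ]
  [∀ n : ℤ, (CategoryTheory.shiftFunctor T n).Additive] [Pretriangulated T]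
  [HasCoproducts.{v} T]

/-- An action of the graded ring `R` on the triangulated category `T`, i.e. a homomorphism of
graded rings from `R` to the graded center of `T`: each homogeneous `a ∈ R` of degree `i`
determines a natural transformation `Id → Σⁱ` commuting with the shift up to the sign
`(-1)^i`. -/
structure CenterAction where
  act : ∀ (i : ℤ) (a : R), a ∈ 𝒜 i → ∀ X : T, X ⟶ X⟦i⟧
  act_add : ∀ (i : ℤ) (a b : R) (ha : a ∈ 𝒜 i) (hb : b ∈ 𝒜 i) (X : T),
    act i (a + b) (add_mem ha hb) X = act i a ha X + act i b hb X
  act_one : ∀ X : T, act 0 1 (SetLike.one_mem_graded 𝒜) X = (shiftFunctorZero T ℤ).inv.app X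
  act_mul : ∀ (i j : ℤ) (a b : R) (ha : a ∈ 𝒜 i) (hb : b ∈ 𝒜 j) (X : T),
    act (i + j) (a * b) (SetLike.mul_mem_graded ha hb) X
      = act j b hb X ≫ act i a ha (X⟦j⟧) ≫ (shiftFunctorAdd' T j i (i + j) (by ring)).inv.app X
  act_natural : ∀ (i : ℤ) (a : R) (ha : a ∈ 𝒜 i) {X Y : T} (f : X ⟶ Y),
    f ≫ act i a ha Y = act i a ha X ≫ f⟦i⟧'
  act_shift : ∀ (i : ℤ) (a : R) (ha : a ∈ 𝒜 i) (X : T) (n : ℤ),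
    act i a ha (X⟦n⟧)
      = ((-1 : ℤ) ^ (i * n).natAbs) • ((act i a ha X)⟦n⟧' ≫ (shiftComm X i n).hom)

variable {𝒜 T}

/-- The action of a homogeneous element of `R` on the graded abelian group
`Hom*(X, Y) = ⊕ₙ Hom(X, Y⟦n⟧)`. -/
def CenterAction.hsmul (A : CenterAction 𝒜 T) {i : ℤ} {a : R} (ha : a ∈ 𝒜 i) {X Y : T} {n : ℤ}
    (f : X ⟶ Y⟦n⟧) : X ⟶ Y⟦n + i⟧ :=
  f ≫ A.act i a ha (Y⟦n⟧) ≫ (shiftFunctorAdd' T n i (n + i) rfl).inv.app Y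

/-- The homogeneous localization of the graded `R`-module `Hom*(X, Y)` at the homogeneous
prime `p` vanishes: every element is annihilated by some homogeneous `s ∉ p`. -/
def LocVanishes (A : CenterAction 𝒜 T) (p : SpecR 𝒜) (X Y : T) : Prop :=
  ∀ (n : ℤ) (f : X ⟶ Y⟦n⟧), ∃ (i : ℤ) (s : R) (hs : s ∈ 𝒜 i),
    s ∉ p.1.toIdeal ∧ A.hsmul hs f = 0

variable (T) in
/-- The subcategory `T_V` of `V`-torsion objects, for `V ⊆ Spec R` specialization closed. -/
def TVset (A : CenterAction 𝒜 T) (V : Set (SpecR 𝒜)) : Set T :=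
  {X | ∀ C : T, IsCompactObj T C → ∀ p : SpecR 𝒜, p ∉ V → LocVanishes A p C X}

/-- The local cohomology and localization functors `Γ_V`, `L_V` attached to the `R`-action on
`T`: for each specialization closed `V ⊆ Spec R`, `L_V` is the (essentially unique) localization
functor with `Ker L_V = T_V`, and `Γ_V` is defined by the exact localization triangle
`Γ_V X → X → L_V X → `. -/
structure BIKData (A : CenterAction 𝒜 T) where
  Γ : Set (SpecR 𝒜) → T ⥤ T
  Lf : Set (SpecR 𝒜) → T ⥤ T
  γ : ∀ V : Set (SpecR 𝒜), Γ V ⟶ 𝟭 T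
  η : ∀ V : Set (SpecR 𝒜), 𝟭 T ⟶ Lf V
  δ : ∀ (V : Set (SpecR 𝒜)) (X : T), (Lf V).obj X ⟶ ((Γ V).obj X)⟦(1 : ℤ)⟧
  tri : ∀ V : Set (SpecR 𝒜), SpecClosed V → ∀ X : T,
    Triangle.mk ((γ V).app X) ((η V).app X) (δ V X) ∈ distTriang T
  Lη_iso : ∀ V : Set (SpecR 𝒜), SpecClosed V → ∀ X : T,
    IsIso ((Lf V).map ((η V).app X))
  Lη_eq : ∀ V : Set (SpecR 𝒜), SpecClosed V → ∀ X : T,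
    (Lf V).map ((η V).app X) = (η V).app ((Lf V).obj X)
  kerL : ∀ V : Set (SpecR 𝒜), SpecClosed V → ∀ X : T,
    Limits.IsZero ((Lf V).obj X) ↔ X ∈ TVset T A V

namespace BIKData

variable {A : CenterAction 𝒜 T} (B : BIKData A)

/-- `X_p = L_{Z(p)} X`. -/
def locP (p : SpecR 𝒜) (X : T) : T := (B.Lf (Zset p)).obj X

/-- `Γ_p = Γ_{V(p)} ∘ L_{Z(p)}`. -/
def ΓP (p : SpecR 𝒜) : T ⥤ T := B.Lf (Zset p) ⋙ B.Γ (Vp p)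

/-- `supp_R X = { p ∈ Spec R | Γ_p X ≠ 0 }`. -/
def suppObj (X : T) : Set (SpecR 𝒜) := {p | ¬ Limits.IsZero ((B.ΓP p).obj X)}

/-- `supp_R T = ⋃_X supp_R X`. -/
def suppT : Set (SpecR 𝒜) := {p | ∃ X : T, p ∈ B.suppObj X}

/-- The support of a class of objects. -/
def suppSet (S : Set T) : Set (SpecR 𝒜) := ⋃ X ∈ S, B.suppObj X

/-- `supp_R⁻¹ U`, the class of objects supported in `U`. -/
def invSupp (U : Set (SpecR 𝒜)) : Set T := {X | B.suppObj X ⊆ U}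

/-- `Γ_p T`, the essential image of `Γ_p`. -/
def ΓPImage (p : SpecR 𝒜) : Set T := {X | ∃ Y : T, Nonempty (X ≅ (B.ΓP p).obj Y)}

/-- The local-global principle: each object is built from its local cohomology objects. -/
def LocalGlobal : Prop :=
  ∀ X : T, Loc T {X} = Loc T {Y | ∃ p : SpecR 𝒜, Y = (B.ΓP p).obj X}

end BIKData

/-- A localizing subcategory is minimal if it is nonzero and has no proper nonzero localizing
subcategories. -/
def IsMinimalLoc (S : Set T) : Prop :=
  IsLocalizing T S ∧ (∃ X ∈ S, ¬ Limits.IsZero X) ∧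
    ∀ S' : Set T, IsLocalizing T S' → S' ⊆ S →
      (∀ X ∈ S', Limits.IsZero X) ∨ S' = S

/-- `T` is stratified by the `R`-action: the local-global principle holds and each `Γ_p T`
is either zero or a minimal localizing subcategory. -/
def Stratified {A : CenterAction 𝒜 T} (B : BIKData A) : Prop :=
  B.LocalGlobal ∧
    ∀ p : SpecR 𝒜, (∀ X ∈ B.ΓPImage p, Limits.IsZero X) ∨ IsMinimalLoc (B.ΓPImage p)

/-- A graded `R`-submodule of `Hom*(X,Y)`. -/
structure HomSub (A : CenterAction 𝒜 T) (X Y : T) where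
  car : ∀ n : ℤ, AddSubgroup (X ⟶ Y⟦n⟧)
  hsmul_mem : ∀ (i : ℤ) (a : R) (ha : a ∈ 𝒜 i) (n : ℤ) (f : X ⟶ Y⟦n⟧),
    f ∈ car n → A.hsmul ha f ∈ car (n + i)

/-- The graded `R`-module `Hom*(X,Y)` is finitely generated. -/
def FGHom (A : CenterAction 𝒜 T) (X Y : T) : Prop :=
  ∃ F : Finset ((n : ℤ) × (X ⟶ Y⟦n⟧)),
    ∀ S : HomSub A X Y, (∀ g ∈ F, g.2 ∈ S.car g.1) → ∀ (n : ℤ) (f : X ⟶ Y⟦n⟧), f ∈ S.car n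

/-- The `R`-linear category `T` is noetherian: `End*(C)` is a finitely generated `R`-module
for each compact object `C`. -/
def NoetherianT (A : CenterAction 𝒜 T) : Prop :=
  ∀ C : T, IsCompactObj T C → FGHom A C C

end Action

section Extra

variable {R : Type u} [Ring R] {𝒜 : ℤ → AddSubgroup R} [GradedRing 𝒜]
variable {T : Type u'} [Category.{v} T] [HasZeroObject T] [Preadditive T] [HasShift T ℤ]
  [∀ n : ℤ, (CategoryTheory.shiftFunctor T n).Additive] [Pretriangulated T]
  [HasCoproducts.{v} T]

/-- A subset of `Spec R` closed under generalization. -/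
def GenClosed (U : Set (SpecR 𝒜)) : Prop :=
  ∀ p q : SpecR 𝒜, q ∈ U → p.1.toIdeal ≤ q.1.toIdeal → p ∈ U

/-- `Supp_R Hom*(X,Y) = { p | Hom*(X,Y)_p ≠ 0 }`, the big support of the graded `R`-module
`Hom*(X,Y)`. -/
def bigSuppHom (A : CenterAction 𝒜 T) (X Y : T) : Set (SpecR 𝒜) :=
  {p | ¬ LocVanishes A p X Y}

/-- `Supp_R X = ⋃_{C compact} Supp_R Hom*(C,X)`, the big support of an object. -/
def bigSuppObj (A : CenterAction 𝒜 T) (X : T) : Set (SpecR 𝒜) :=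
  {p | ∃ C : T, IsCompactObj T C ∧ ¬ LocVanishes A p C X}

/-- The graded `R`-module `Hom*(X,Y)` is `p`-local: every homogeneous element outside of `p`
acts invertibly on it. -/
def PLocalHom (A : CenterAction 𝒜 T) (p : SpecR 𝒜) (X Y : T) : Prop :=
  ∀ (i : ℤ) (s : R) (hs : s ∈ 𝒜 i), s ∉ p.1.toIdeal →
    ∀ n : ℤ, Function.Bijective fun f : X ⟶ Y⟦n⟧ => A.hsmul hs f

/-- `K` is a Koszul object `X ⫽ a` of the homogeneous element `a` of degree `i` on `X`,
i.e. there is an exact triangle `X → Σ^i X → K → `, the first map being given by the action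
of `a`. -/
def IsKoszul (A : CenterAction 𝒜 T) {i : ℤ} (a : R) (ha : a ∈ 𝒜 i) (X K : T) : Prop :=
  ∃ (w : X⟦i⟧ ⟶ K) (d : K ⟶ X⟦(1 : ℤ)⟧),
    Triangle.mk (A.act i a ha X) w d ∈ distTriang T

/-- Iterated Koszul object on a finite sequence of homogeneous elements. -/
inductive IsKoszulSeq (A : CenterAction 𝒜 T) :
    T → List ((i : ℤ) × {a : R // a ∈ 𝒜 i}) → T → Prop
  | nil (X : T) : IsKoszulSeq A X [] X
  | cons (X Y K : T) (i : ℤ) (a : {a : R // a ∈ 𝒜 i})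
      (l : List ((i : ℤ) × {a : R // a ∈ 𝒜 i})) :
      IsKoszulSeq A X l Y → IsKoszul A a.1 a.2 Y K → IsKoszulSeq A X (⟨i, a⟩ :: l) K

/-- `K` is a Koszul object `X ⫽ 𝔞` of the homogeneous ideal `𝔞` on `X`, obtained by iterating
the Koszul construction on some finite sequence of homogeneous generators of `𝔞`. -/
def IsKoszulIdeal (A : CenterAction 𝒜 T) (𝔞 : HomogeneousIdeal 𝒜) (X K : T) : Prop :=
  ∃ l : List ((i : ℤ) × {a : R // a ∈ 𝒜 i}),
    Ideal.span {x : R | ∃ s ∈ l, (s.2 : R) = x} = 𝔞.toIdeal ∧ IsKoszulSeq A X l K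

end Extra

section Hocolim

variable {T : Type u'} [Category.{v} T] [Preadditive T] [HasCoproductsOfShape ℕ T]

/-- The map `⊕ₙ Xₙ → ⊕ₙ Xₙ` given by `id - fₙ`, whose cone is the homotopy colimit. -/
noncomputable def hoColimMap {Xs : ℕ → T} (fs : ∀ n, Xs n ⟶ Xs (n + 1)) : (∐ Xs) ⟶ (∐ Xs) :=
  Sigma.desc fun n => Sigma.ι Xs n - fs n ≫ Sigma.ι Xs (n + 1)

variable [HasZeroObject T] [HasShift T ℤ]
  [∀ n : ℤ, (CategoryTheory.shiftFunctor T n).Additive] [Pretriangulated T]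

/-- A homotopy colimit of the sequence `X₀ → X₁ → X₂ → ⋯`, defined by an exact triangle
`⊕ Xₙ → ⊕ Xₙ → hocolim Xₙ → `. -/
structure HocolimData (Xs : ℕ → T) (fs : ∀ n, Xs n ⟶ Xs (n + 1)) where
  pt : T
  ι : (∐ Xs) ⟶ pt
  d : pt ⟶ (∐ Xs)⟦(1 : ℤ)⟧
  tri : Triangle.mk (hoColimMap fs) ι d ∈ distTriang T

end Hocolim

end BIK
namespace BIK

section InjHull

variable {R : Type v} [Ring R]

/-- `E` is an essential extension of `N`, inside the module `J`. -/
def EssIn {J : Type v} [AddCommGroup J] [Module R J] (N E : Submodule R J) : Prop :=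
  N ≤ E ∧ ∀ x ∈ E, x ≠ 0 → ∃ r : R, r • x ∈ N ∧ r • x ≠ 0

lemma exists_maxEss {J : Type v} [AddCommGroup J] [Module R J] (N : Submodule R J) :
    ∃ E : Submodule R J, EssIn N E ∧ ∀ E', EssIn N E' → E ≤ E' → E' = E := by
  obtain ⟨E, _, hE⟩ := zorn_le_nonempty₀ {E | EssIn N E} (fun c hc hch y hy => by
    refine ⟨sSup c, ⟨(hc hy).1.trans (le_sSup hy), ?_⟩, fun z hz => le_sSup hz⟩
    intro x hx hx0
    rw [Submodule.mem_sSup_of_directed ⟨y, hy⟩ hch.directedOn] at hx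
    obtain ⟨z, hz, hxz⟩ := hx
    exact (hc hz).2 x hxz hx0) N ⟨le_rfl, fun x hx hx0 => ⟨1, by simpa, by simpa⟩⟩
  exact ⟨E, hE.prop, fun E' h1 h2 => le_antisymm (hE.le_of_ge h1 h2) h2⟩

lemma exists_maxDisj {J : Type v} [AddCommGroup J] [Module R J] (E : Submodule R J) :
    ∃ K : Submodule R J, Disjoint K E ∧ ∀ K', Disjoint K' E → K ≤ K' → K' = K := by
  obtain ⟨K, _, hK⟩ := zorn_le_nonempty₀ {K : Submodule R J | Disjoint K E}
    (fun c hc hch y hy => by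
      refine ⟨sSup c, ?_, fun z hz => le_sSup hz⟩
      rw [Set.mem_ofPred_eq, Submodule.disjoint_def]
      intro x hx hxE
      rw [Submodule.mem_sSup_of_directed ⟨y, hy⟩ hch.directedOn] at hx
      obtain ⟨z, hz, hxz⟩ := hx
      exact (Submodule.disjoint_def.1 (hc hz)) x hxz hxE) ⊥ disjoint_bot_left
  exact ⟨K, hK.prop, fun E' h1 h2 => le_antisymm (hK.le_of_ge h1 h2) h2⟩

lemma exists_retract {J : Type v} [AddCommGroup J] [Module R J] (hJ : Module.Injective R J)
    (N E : Submodule R J) (hE : EssIn N E) (hmax : ∀ E', EssIn N E' → E ≤ E' → E' = E) :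
    ∃ ρ : J →ₗ[R] E, ∀ x : E, ρ x = x := by
  obtain ⟨K, hK, hKmax⟩ := exists_maxDisj E
  let i : E →ₗ[R] (J ⧸ K) := K.mkQ ∘ₗ E.subtype
  have hi : Function.Injective i := by
    rw [injective_iff_map_eq_zero]
    intro x hx
    have : (x : J) ∈ K := by simpa [i] using hx
    exact Subtype.ext (Submodule.disjoint_def.1 hK _ this x.2)
  obtain ⟨h, hh⟩ := hJ.out i hi E.subtype
  have hh' : ∀ x ∈ E, h (K.mkQ x) = x := fun x hx => hh ⟨x, hx⟩
  have hker : ∀ z, h (K.mkQ z) = 0 → z ∈ K := by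
    have : (LinearMap.ker (h ∘ₗ K.mkQ)) = K := by
      apply hKmax
      · rw [Submodule.disjoint_def]
        intro x hx hxE
        rw [← hh' x hxE]; exact hx
      · intro x hx
        have : K.mkQ x = 0 := by simpa using hx
        simp [LinearMap.mem_ker, this]
    intro z hz
    rw [← this]; exact hz
  have hr : LinearMap.range (h ∘ₗ K.mkQ) = E := by
    apply hmax
    · refine ⟨fun x hx => ⟨x, hh' x (hE.1 hx)⟩, ?_⟩
      rintro _ ⟨z, rfl⟩ hz
      have hzK : z ∉ K := by
        intro h'
        apply hz
        have : K.mkQ z = 0 := by simpa using h'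
        simp [this]
      have : ¬ Disjoint (K ⊔ Submodule.span R {z}) E := by
        intro hd
        have := hKmax _ hd le_sup_left
        apply hzK
        rw [← this]
        exact (le_sup_right : _ ≤ K ⊔ Submodule.span R {z}) (Submodule.mem_span_singleton_self z)
      rw [Submodule.disjoint_def] at this
      push Not at this
      obtain ⟨e, he, heE, he0⟩ := this
      obtain ⟨k, hk, y, hy, rfl⟩ := Submodule.mem_sup.1 he
      obtain ⟨r, rfl⟩ := Submodule.mem_span_singleton.1 hy
      have hk0 : K.mkQ k = 0 := by simpa using hk
      have h1 : r • (h ∘ₗ K.mkQ) z = k + r • z := by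
        rw [← hh' _ heE, map_add, hk0]; simp
      obtain ⟨r', h2, h3⟩ := hE.2 _ heE he0
      refine ⟨r' * r, ?_, ?_⟩
      · rw [mul_smul, h1]; exact h2
      · rw [mul_smul, h1]; exact h3
    · exact fun x hx => ⟨x, hh' x hx⟩
  refine ⟨LinearMap.codRestrict E (h ∘ₗ K.mkQ) (fun z => by rw [← hr]; exact ⟨z, rfl⟩), ?_⟩
  intro x
  exact Subtype.ext (hh' x x.2)

lemma exists_injHull [IsNoetherianRing R] (q : Ideal R) :
    ∃ (E : Type v) (_ : AddCommGroup E) (_ : Module R E) (e₀ : E), Module.Injective R E ∧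
      (∀ r : R, r • e₀ = 0 ↔ r ∈ q) ∧
      (∀ t : R, (∀ r, t * r = r * t) → (∀ x, t * x ∈ q → x ∈ q) → ∀ e : E, t • e = 0 → e = 0) ∧
      (∀ t : R, (∀ r, t * r = r * t) → t ∈ q → ∀ e : E, ∃ n : ℕ, t ^ n • e = 0) := by
  let J : ModuleCat.{v} R := CategoryTheory.Injective.under (ModuleCat.of R (R ⧸ q))
  let ι : ModuleCat.of R (R ⧸ q) ⟶ J := CategoryTheory.Injective.ι (ModuleCat.of R (R ⧸ q))
  have hJ : Module.Injective R J :=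
    haveI : CategoryTheory.Injective (ModuleCat.of R J) :=
      inferInstanceAs (CategoryTheory.Injective (CategoryTheory.Injective.under _))
    Module.injective_module_of_injective_object R J
  have hι : Function.Injective ι.hom := (ModuleCat.mono_iff_injective ι).1 inferInstance
  let N : Submodule R J := LinearMap.range ι.hom
  obtain ⟨E, hE, hmax⟩ := exists_maxEss N
  obtain ⟨ρ, hρ⟩ := exists_retract hJ N E hE hmax
  have hN : ∀ x ∈ N, ∃ r : R, x = r • ι.hom (Submodule.Quotient.mk 1) := by
    rintro _ ⟨y, rfl⟩
    obtain ⟨r, rfl⟩ := Submodule.Quotient.mk_surjective q y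
    refine ⟨r, ?_⟩
    rw [← map_smul]
    congr 1
    change _ = Submodule.Quotient.mk (r • (1 : R))
    simp
  have hann : ∀ r : R, r • ι.hom (Submodule.Quotient.mk 1) = 0 ↔ r ∈ q := by
    intro r
    rw [← map_smul, map_eq_zero_iff _ hι, ← Submodule.Quotient.mk_smul,
      Submodule.Quotient.mk_eq_zero]
    simp
  refine ⟨E, inferInstance, inferInstance, ⟨ι.hom (Submodule.Quotient.mk 1), hE.1 ⟨_, rfl⟩⟩,
    ⟨?_⟩, ?_, ?_, ?_⟩
  · intro X Y _ _ _ _ f hf g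
    obtain ⟨h, hh⟩ := hJ.out f hf (E.subtype ∘ₗ g)
    refine ⟨ρ ∘ₗ h, fun x => ?_⟩
    simp [hh, hρ]
  · intro r
    rw [← hann r, ← Subtype.coe_inj]; rfl
  · intro t ht htq e he
    by_contra h0
    obtain ⟨r, h1, h2⟩ := hE.2 e.1 e.2 (by simpa using h0)
    obtain ⟨r', hr'⟩ := hN _ h1
    apply h2
    rw [hr']
    refine (hann r').2 (htq _ ((hann _).1 ?_))
    rw [mul_smul]
    change t • r' • ι.hom (Submodule.Quotient.mk 1) = 0
    rw [← hr', ← mul_smul, ht, mul_smul]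
    have : t • (e : J) = 0 := by simpa using congrArg Subtype.val he
    rw [this, smul_zero]
  · intro t ht htq e
    let tl : J →ₗ[R] J :=
      { toFun := fun x => t • x
        map_add' := by simp
        map_smul' := fun r x => by
          simp only [RingHom.id_apply]; rw [← mul_smul, ht, mul_smul] }
    let M : Submodule R J := Submodule.span R {e.1}
    have htM : ∀ x ∈ M, tl x ∈ M := fun x hx => M.smul_mem t hx
    have hME : M ≤ E := by
      rw [Submodule.span_singleton_le_iff_mem]; exact e.2
    let f : M →ₗ[R] M := tl.restrict htM
    have : IsNoetherian R M := isNoetherian_of_fg_of_noetherian M (Submodule.fg_span_singleton _)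
    have hdis := Module.End.eventually_disjoint_ker_pow_range_pow f
    obtain ⟨n, hn⟩ := Filter.eventually_atTop.1 hdis
    have hfp : ∀ (k : ℕ) (x : M), ((f ^ k) x : J) = t ^ k • (x : J) := by
      intro k
      induction k with
      | zero => intro x; simp
      | succ k ih =>
        intro x
        rw [pow_succ', Module.End.mul_apply, pow_succ', mul_smul, ← ih]
        rfl
    have hn1 := hn (n + 1) (by omega)
    refine ⟨n + 1, ?_⟩
    by_contra h0
    have h0' : t ^ (n + 1) • (e : J) ≠ 0 := by
      intro h; apply h0; exact Subtype.ext (by simpa using h)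
    obtain ⟨r, h1, h2⟩ := hE.2 (t ^ (n + 1) • (e : J)) (E.smul_mem _ e.2) h0'
    obtain ⟨r', hr'⟩ := hN _ h1
    apply h2
    let y : M := r • (f ^ (n + 1)) ⟨e.1, Submodule.mem_span_singleton_self _⟩
    have hy : (y : J) = r • t ^ (n + 1) • (e : J) := by
      simp only [y, Submodule.coe_smul, hfp]
    have hyr : y ∈ LinearMap.range (f ^ (n + 1)) := Submodule.smul_mem _ _ ⟨_, rfl⟩
    have hyk : y ∈ LinearMap.ker (f ^ (n + 1)) := by
      rw [LinearMap.mem_ker]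
      apply Subtype.ext
      rw [hfp, hy, hr']
      change _ = (0 : J)
      rw [pow_succ, mul_smul, ← mul_smul t, ht]
      rw [(hann (r' * t)).2 (q.mul_mem_left _ htq), smul_zero]
    have := Submodule.disjoint_def.1 hn1 y hyk hyr
    rw [← hy, this]; rfl

end InjHull
end BIK

namespace BIK

section Compact

variable {T : Type u'} [Category.{v} T] [HasZeroObject T] [Preadditive T] [HasShift T ℤ]
  [∀ n : ℤ, (CategoryTheory.shiftFunctor T n).Additive] [Pretriangulated T]
  [HasCoproducts.{v} T]

open Classical in
/-- The projection of a coproduct onto a finite subcoproduct. -/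
noncomputable def eF {J : Type v} (f : J → T) (F : Finset J) : (∐ f) ⟶ (∐ f) :=
  ∑ j ∈ F, Sigma.π f j ≫ Sigma.ι f j

open Classical in
lemma ι_eF {J : Type v} (f : J → T) (F : Finset J) (j : J) :
    Sigma.ι f j ≫ eF f F = if j ∈ F then Sigma.ι f j else 0 := by
  rw [eF, Preadditive.comp_sum]
  have h : ∀ i ∈ F, Sigma.ι f j ≫ Sigma.π f i ≫ Sigma.ι f i
      = if j = i then Sigma.ι f j else 0 := by
    intro i _
    by_cases h : j = i
    · subst h; rw [Sigma.ι_π_eq_id_assoc, if_pos rfl]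
    · rw [if_neg h, ← Category.assoc, Sigma.ι_π_of_ne f h, zero_comp]
  rw [Finset.sum_congr rfl h]
  simp

lemma eF_comp {J : Type v} (f : J → T) {F G : Finset J} (h : F ⊆ G) :
    eF f F ≫ eF f G = eF f F := by
  classical
  apply Sigma.hom_ext
  intro j
  rw [← Category.assoc, ι_eF]
  split_ifs with hj
  · rw [ι_eF, if_pos (h hj)]
  · simp

lemma eF_comp' {J : Type v} (f : J → T) {F G : Finset J} (h : F ⊆ G) :
    eF f G ≫ eF f F = eF f F := by
  classical
  apply Sigma.hom_ext
  intro j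
  rw [← Category.assoc, ι_eF, ι_eF]
  split_ifs with h1 h2 h2
  · rw [ι_eF, if_pos h2]
  · rw [ι_eF, if_neg h2]
  · exact absurd (h h2) h1
  · simp

lemma eF_mono {J : Type v} (f : J → T) {F G : Finset J} (h : F ⊆ G) {C : T} {k : C ⟶ ∐ f}
    (hk : k ≫ eF f F = k) : k ≫ eF f G = k := by
  rw [← hk, Category.assoc, eF_comp f h]

lemma sigmaHom_of (C : T) {J : Type v} [DecidableEq J] (f : J → T) (j : J) (g : C ⟶ f j) :
    sigmaHom T C f (DirectSum.of (fun j => (C ⟶ f j)) j g) = g ≫ Sigma.ι f j := by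
  unfold sigmaHom
  have e : ‹DecidableEq J› = Classical.decEq J := Subsingleton.elim _ _
  subst e
  simp [DirectSum.toAddMonoid_of]

lemma compact_iff (C : T) : IsCompactObj T C ↔
    ∀ (J : Type v) (f : J → T) (h : C ⟶ ∐ f), ∃ F : Finset J, h ≫ eF f F = h := by
  classical
  constructor
  · intro hC J f h
    obtain ⟨x, rfl⟩ := (hC J f).2 h
    induction x using DirectSum.induction_on with
    | zero => exact ⟨∅, by simp⟩
    | of j g =>
      refine ⟨{j}, ?_⟩
      rw [sigmaHom_of, Category.assoc, ι_eF, if_pos (by simp)]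
    | add x y hx hy =>
      obtain ⟨F, hF⟩ := hx
      obtain ⟨G, hG⟩ := hy
      refine ⟨F ∪ G, ?_⟩
      rw [map_add, Preadditive.add_comp, eF_mono f Finset.subset_union_left hF,
        eF_mono f Finset.subset_union_right hG]
  · intro hC J f
    constructor
    · rw [injective_iff_map_eq_zero]
      intro x hx
      have key : ∀ (x : DirectSum J fun j => (C ⟶ f j)) (j : J),
          sigmaHom T C f x ≫ Sigma.π f j = x j := by
        intro x j
        induction x using DirectSum.induction_on with
        | zero => simp
        | of i g =>
          rw [sigmaHom_of]
          by_cases h : i = j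
          · subst h
            rw [Category.assoc, Sigma.ι_π_eq_id, DirectSum.of_eq_same, Category.comp_id]
          · rw [Category.assoc, Sigma.ι_π_of_ne f h, DirectSum.of_eq_of_ne _ _ _ (Ne.symm h),
              comp_zero]
        | add x y hx hy =>
          rw [map_add, Preadditive.add_comp, hx, hy]; rfl
      ext j
      rw [← key, hx, zero_comp]; rfl
    · intro h
      obtain ⟨F, hF⟩ := hC J f h
      refine ⟨∑ j ∈ F, DirectSum.of (fun j => (C ⟶ f j)) j (h ≫ Sigma.π f j), ?_⟩
      rw [map_sum]
      conv_rhs => rw [← hF, eF, Preadditive.comp_sum]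
      refine Finset.sum_congr rfl fun j _ => ?_
      rw [sigmaHom_of, Category.assoc]

/-- `Hom(C, -)` out of a compact object into a shifted coproduct. -/
lemma compact_shift_fac {C : T} (hC : IsCompactObj T C) {J : Type v} (f : J → T) (n : ℤ)
    (h : C ⟶ (∐ f)⟦n⟧) : ∃ F : Finset J, h ≫ (eF f F)⟦n⟧' = h := by
  classical
  let e := PreservesCoproduct.iso (shiftFunctor T n) f
  obtain ⟨F, hF⟩ := (compact_iff C).1 hC J (fun j => (f j)⟦n⟧) (h ≫ e.hom)
  refine ⟨F, ?_⟩
  have hι : ∀ j, Sigma.ι (fun j => (f j)⟦n⟧) j ≫ e.inv = (Sigma.ι f j)⟦n⟧' := by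
    intro j
    simp [e, PreservesCoproduct.inv_hom]
  have key : eF (fun j => (f j)⟦n⟧) F ≫ e.inv = e.inv ≫ (eF f F)⟦n⟧' := by
    apply Sigma.hom_ext
    intro j
    rw [← Category.assoc, ι_eF, ← Category.assoc, hι, ← Functor.map_comp, ι_eF]
    split_ifs
    · rw [hι]
    · simp
  have : h = (h ≫ e.hom) ≫ e.inv := by simp
  conv_rhs => rw [this, ← hF]
  rw [Category.assoc, key]
  simp

lemma compact_shift {C : T} (hC : IsCompactObj T C) (n : ℤ) : IsCompactObj T (C⟦n⟧) := by
  rw [compact_iff]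
  intro J f h
  obtain ⟨F, hF⟩ := compact_shift_fac hC f (-n) ((shiftShiftNeg C n).inv ≫ h⟦-n⟧')
  refine ⟨F, ?_⟩
  rw [Category.assoc, ← Functor.map_comp] at hF
  have := (cancel_epi _).1 hF
  exact (shiftFunctor T (-n)).map_injective this

lemma compact_cone (Tr : Triangle T) (hTr : Tr ∈ distTriang T) (h1 : IsCompactObj T Tr.obj₁)
    (h2 : IsCompactObj T Tr.obj₂) : IsCompactObj T Tr.obj₃ := by
  classical
  have h1' := compact_shift h1 1
  rw [compact_iff] at *
  intro J f h
  obtain ⟨F, hF⟩ := h2 J f (Tr.mor₂ ≫ h)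
  obtain ⟨k, hk⟩ := Triangle.yoneda_exact₃ Tr hTr (h ≫ (𝟙 _ - eF f F)) (by
    simp only [Preadditive.comp_sub, Category.comp_id]
    rw [← Category.assoc Tr.mor₂ h (eF f F), hF, sub_self])
  obtain ⟨G, hG⟩ := h1' J f k
  refine ⟨F ∪ G, ?_⟩
  have e1 : (h ≫ (𝟙 _ - eF f F)) ≫ eF f (F ∪ G) = h ≫ (𝟙 _ - eF f F) := by
    rw [hk, Category.assoc, eF_mono f Finset.subset_union_right hG]
  simp only [Preadditive.comp_sub, Preadditive.sub_comp, Category.comp_id, Category.assoc] at e1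
  rw [eF_comp f Finset.subset_union_left] at e1
  exact sub_left_injective e1

lemma compact_iso {C D : T} (e : C ≅ D) (hC : IsCompactObj T C) : IsCompactObj T D := by
  rw [compact_iff] at *
  intro J f h
  obtain ⟨F, hF⟩ := hC J f (e.hom ≫ h)
  refine ⟨F, ?_⟩
  rw [Category.assoc] at hF
  exact (cancel_epi _).1 hF

lemma compact_biprod {C D : T} (hC : IsCompactObj T C) (hD : IsCompactObj T D) :
    IsCompactObj T (C ⊞ D) := by
  classical
  rw [compact_iff] at *
  intro J f h
  obtain ⟨F, hF⟩ := hC J f (biprod.inl ≫ h)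
  obtain ⟨G, hG⟩ := hD J f (biprod.inr ≫ h)
  refine ⟨F ∪ G, ?_⟩
  apply biprod.hom_ext'
  · rw [← Category.assoc, eF_mono f Finset.subset_union_left hF]
  · rw [← Category.assoc, eF_mono f Finset.subset_union_right hG]

open Classical in
lemma compact_hom_ext {C : T} (hC : IsCompactObj T C) {J : Type v} (f : J → T) (h : C ⟶ ∐ f)
    (h0 : ∀ j, h ≫ Sigma.π f j = 0) : h = 0 := by
  obtain ⟨F, hF⟩ := (compact_iff C).1 hC J f h
  rw [← hF, eF, Preadditive.comp_sum]
  refine Finset.sum_eq_zero fun j _ => ?_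
  rw [← Category.assoc, h0, zero_comp]

lemma loc_isLocalizing (A : Set T) : IsLocalizing T (Loc T A) where
  zero_mem X hX := fun S hS => hS.1.zero_mem X hX
  iso_mem e h := fun S hS => hS.1.iso_mem e (h S hS)
  shift_mem X h n := fun S hS => hS.1.shift_mem X (h S hS) n
  ext_mem Tr hTr h1 h2 := fun S hS => hS.1.ext_mem Tr hTr (h1 S hS) (h2 S hS)
  coprod_mem J f h := fun S hS => hS.1.coprod_mem J f (fun j => h j S hS)

lemma loc_le {A S : Set T} (hS : IsLocalizing T S) (h : A ⊆ S) : Loc T A ⊆ S :=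
  fun _ hX => hX S ⟨hS, h⟩

lemma subset_loc (A : Set T) : A ⊆ Loc T A := fun _ hX _ hS => hS.2 hX

/-- An object receiving no maps from compact objects is zero. -/
lemma isZero_of_compact (hgen : CompactlyGen T) (X : T)
    (h : ∀ C : T, IsCompactObj T C → ∀ f : C ⟶ X, f = 0) : IsZero X := by
  obtain ⟨ι, g, hg, hloc⟩ := hgen
  have hS : IsLocalizing T {Y : T | ∀ (n : ℤ) (f : Y⟦n⟧ ⟶ X), f = 0} := by
    constructor
    · intro Y hY n f
      exact ((shiftFunctor T n).map_isZero hY).eq_of_src _ _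
    · intro Y Z e hY n f
      have := hY n (e.hom⟦n⟧' ≫ f)
      rw [← cancel_epi (e.hom⟦n⟧'), this, comp_zero]
    · intro Y hY m n f
      have := hY (m + n) ((shiftFunctorAdd T m n).hom.app Y ≫ f)
      rw [← cancel_epi ((shiftFunctorAdd T m n).hom.app Y), this, comp_zero]
    · intro Tr hTr h1 h2 n f
      obtain ⟨k, hk⟩ := Triangle.yoneda_exact₃ _ (Triangle.shift_distinguished Tr hTr n) f
        (h2 n _)
      have hk0 : ∀ k' : ((Tr.obj₁)⟦n⟧)⟦(1 : ℤ)⟧ ⟶ X, k' = 0 := by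
        intro k'
        have := h1 (n + 1) ((shiftFunctorAdd T n 1).hom.app Tr.obj₁ ≫ k')
        exact (cancel_epi ((shiftFunctorAdd T n 1).hom.app Tr.obj₁)).1
          (this.trans comp_zero.symm)
      have hk1 := hk0 k
      rw [hk, hk1]
      exact comp_zero
    · intro J f hf n k
      rw [← cancel_epi (sigmaComparison (shiftFunctor T n) f), comp_zero]
      apply Sigma.hom_ext
      intro j
      rw [comp_zero, ← Category.assoc]
      exact hf j n _
  have : X ∈ {Y : T | ∀ (n : ℤ) (f : Y⟦n⟧ ⟶ X), f = 0} := by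
    apply loc_le hS (A := Set.range g)
    · rintro _ ⟨i, rfl⟩ n f
      exact h _ (compact_shift (hg i) n) f
    · rw [hloc]; trivial
  rw [IsZero.iff_id_eq_zero]
  have h0 := this 0 ((shiftFunctorZero T ℤ).hom.app X)
  rw [← cancel_epi ((shiftFunctorZero T ℤ).hom.app X)]
  rw [h0]; simp

end Compact
end BIK

set_option linter.unusedSectionVars false
namespace BIK

section Brown

variable (T : Type u') [Category.{v} T] [HasZeroObject T] [Preadditive T] [HasShift T ℤ]
  [∀ n : ℤ, (CategoryTheory.shiftFunctor T n).Additive] [Pretriangulated T]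
  [HasCoproducts.{v} T]

/-- A cohomological functor sending coproducts to products. -/
structure CohFun where
  obj : T → Type v
  grp : ∀ X, AddCommGroup (obj X)
  map : ∀ {X Y : T}, (X ⟶ Y) → obj Y →+ obj X
  map_id : ∀ {X : T} (x : obj X), map (𝟙 X) x = x
  map_comp : ∀ {X Y Z : T} (f : X ⟶ Y) (g : Y ⟶ Z) (x : obj Z), map (f ≫ g) x = map f (map g x)
  map_add : ∀ {X Y : T} (f g : X ⟶ Y) (x : obj Y), map (f + g) x = map f x + map g x
  exact : ∀ Tr ∈ distTriang T, ∀ x : obj Tr.obj₂, map Tr.mor₁ x = 0 →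
    ∃ y : obj Tr.obj₃, map Tr.mor₂ y = x
  coprod : ∀ {J : Type v} (f : J → T),
    Function.Bijective fun (x : obj (∐ f)) (j : J) => map (Sigma.ι f j) x

attribute [instance] CohFun.grp

variable {T} (H : CohFun T)

namespace CohFun

lemma map_zero' {X Y : T} (x : H.obj Y) : H.map (0 : X ⟶ Y) x = 0 := by
  have := H.map_add (0 : X ⟶ Y) 0 x
  rw [add_zero] at this
  exact left_eq_add.mp this

lemma map_neg' {X Y : T} (f : X ⟶ Y) (x : H.obj Y) : H.map (-f) x = -H.map f x := by
  have := H.map_add (-f) f x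
  rw [neg_add_cancel, map_zero'] at this
  exact eq_neg_of_add_eq_zero_left this.symm

lemma map_sub' {X Y : T} (f g : X ⟶ Y) (x : H.obj Y) : H.map (f - g) x = H.map f x - H.map g x := by
  rw [sub_eq_add_neg, H.map_add, map_neg', sub_eq_add_neg]

lemma step {K : Type v} (G : K → T) (X : T) (x : H.obj X) :
    ∃ (X' : T) (f : X ⟶ X') (x' : H.obj X'), H.map f x' = x ∧
      ∀ (k : K) (h : G k ⟶ X), H.map h x = 0 → h ≫ f = 0 := by
  let J := Σ k : K, {h : G k ⟶ X // H.map h x = 0}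
  let F : J → T := fun j => G j.1
  let a : (∐ F) ⟶ X := Sigma.desc fun j => j.2.1
  obtain ⟨X', f, c, hT⟩ := distinguished_cocone_triangle a
  have ha : H.map a x = 0 := by
    apply (H.coprod F).1
    funext j
    simp only [_root_.map_zero]
    rw [← H.map_comp, Sigma.ι_desc]
    exact j.2.2
  obtain ⟨x', hx'⟩ := H.exact _ hT x ha
  refine ⟨X', f, x', hx', fun k h hh => ?_⟩
  have h0 : a ≫ f = 0 := comp_distTriang_mor_zero₁₂ _ hT
  have : Sigma.ι F ⟨k, h, hh⟩ ≫ a = h := Sigma.ι_desc _ _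
  rw [← this, Category.assoc, h0, comp_zero]

/-- The element represents the functor at the object. -/
def Good {I : T} (x : H.obj I) (Y : T) : Prop :=
  Function.Bijective fun g : Y ⟶ I => H.map g x

lemma good_inj {I : T} {x : H.obj I} {Y : T} (h : H.Good x Y) (g : Y ⟶ I)
    (hg : H.map g x = 0) : g = 0 :=
  h.1 (by simp only [hg, map_zero'])

lemma good_mk {I : T} {x : H.obj I} {Y : T} (h : ∀ g : Y ⟶ I, H.map g x = 0 → g = 0)
    (h' : ∀ y : H.obj Y, ∃ g : Y ⟶ I, H.map g x = y) : H.Good x Y := by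
  refine ⟨fun g g' hgg => ?_, h'⟩
  have := h (g - g') (by rw [map_sub']; exact sub_eq_zero.2 hgg)
  exact sub_eq_zero.1 this

lemma good_iso {I : T} {x : H.obj I} {Y Z : T} (e : Y ≅ Z) (h : H.Good x Y) : H.Good x Z := by
  apply H.good_mk
  · intro g hg
    have := H.good_inj h (e.hom ≫ g) (by rw [H.map_comp, hg, _root_.map_zero])
    exact (cancel_epi e.hom).1 (this.trans comp_zero.symm)
  · intro y
    obtain ⟨g, hg⟩ := h.2 (H.map e.hom y)
    refine ⟨e.inv ≫ g, ?_⟩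
    simp only at hg
    rw [H.map_comp, hg, ← H.map_comp, e.inv_hom_id, H.map_id]

lemma good_zero {I : T} {x : H.obj I} {Y : T} (h : IsZero Y) : H.Good x Y := by
  apply H.good_mk
  · intro g _
    exact h.eq_of_src _ _
  · intro y
    refine ⟨0, ?_⟩
    rw [map_zero', ← H.map_id y, h.eq_of_src (𝟙 Y) 0, map_zero']

lemma good_coprod {I : T} {x : H.obj I} {J : Type v} (f : J → T) (h : ∀ j, H.Good x (f j)) :
    H.Good x (∐ f) := by
  apply H.good_mk
  · intro g hg
    apply Sigma.hom_ext
    intro j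
    rw [comp_zero]
    exact H.good_inj (h j) _ (by rw [H.map_comp, hg, _root_.map_zero])
  · intro y
    choose g hg using fun j => (h j).2 (H.map (Sigma.ι f j) y)
    refine ⟨Sigma.desc g, (H.coprod f).1 ?_⟩
    funext j
    simp only
    rw [← H.map_comp, Sigma.ι_desc]
    exact hg j

lemma good_cone {I : T} {x : H.obj I} (Tr : Triangle T) (hTr : Tr ∈ distTriang T)
    (h1 : H.Good x Tr.obj₁) (h2 : H.Good x Tr.obj₂) (h1' : H.Good x (Tr.obj₁⟦(1 : ℤ)⟧))
    (h2' : H.Good x (Tr.obj₂⟦(1 : ℤ)⟧)) : H.Good x Tr.obj₃ := by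
  have hr := rot_of_distTriang _ hTr
  have hrr := rot_of_distTriang _ hr
  apply H.good_mk
  · intro g hg
    have e1 : Tr.mor₂ ≫ g = 0 := H.good_inj h2 _ (by rw [H.map_comp, hg, _root_.map_zero])
    obtain ⟨k, hk⟩ := Triangle.yoneda_exact₃ Tr hTr g e1
    obtain ⟨y, hy⟩ := H.exact _ hrr (H.map k x) (by
      change H.map Tr.mor₃ _ = 0
      rw [← H.map_comp, ← hk, hg])
    obtain ⟨l, hl⟩ := h2'.2 y
    have hl' : k = (-(Tr.mor₁⟦(1 : ℤ)⟧')) ≫ l := by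
      apply h1'.1
      simp only [H.map_comp]
      simp only at hl
      rw [hl]; exact hy.symm
    have h0 : Tr.mor₃ ≫ (-(Tr.mor₁⟦(1 : ℤ)⟧')) = 0 := comp_distTriang_mor_zero₁₂ _ hrr
    rw [hk, hl', ← Category.assoc, h0, zero_comp]
  · intro y
    obtain ⟨m, hm⟩ := h2.2 (H.map Tr.mor₂ y)
    simp only at hm
    have h0 : Tr.mor₁ ≫ Tr.mor₂ = 0 := comp_distTriang_mor_zero₁₂ _ hTr
    have e1 : Tr.mor₁ ≫ m = 0 := H.good_inj h1 _ (by
      rw [H.map_comp, hm, ← H.map_comp, h0, map_zero'])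
    obtain ⟨g, hg⟩ := Triangle.yoneda_exact₂ Tr hTr m e1
    obtain ⟨z, hz⟩ := H.exact _ hr (y - H.map g x) (by
      change H.map Tr.mor₂ _ = 0
      rw [map_sub, ← H.map_comp, ← hg, hm, sub_self])
    obtain ⟨k, hk⟩ := h1'.2 z
    simp only at hk
    refine ⟨g + Tr.mor₃ ≫ k, ?_⟩
    rw [H.map_add, H.map_comp, hk]
    change H.map Tr.mor₃ z = _ at hz
    rw [hz, add_sub_cancel]

end CohFun

/-- `1 - shift` is injective on maps from compact objects. -/
lemma oneSubShift_inj {C : T} (hC : IsCompactObj T C) (Y : ULift.{v} ℕ → T)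
    (fs : ∀ n : ℕ, Y ⟨n⟩ ⟶ Y ⟨n + 1⟩) (a : (∐ Y) ⟶ ∐ Y)
    (ha : ∀ n : ℕ, Sigma.ι Y ⟨n⟩ ≫ a = Sigma.ι Y ⟨n⟩ - fs n ≫ Sigma.ι Y ⟨n + 1⟩)
    (h : C ⟶ ∐ Y) (h0 : h ≫ a = 0) : h = 0 := by
  classical
  apply compact_hom_ext hC
  have key0 : a ≫ Sigma.π Y ⟨0⟩ = Sigma.π Y ⟨0⟩ := by
    apply Sigma.hom_ext
    rintro ⟨n⟩
    rw [← Category.assoc, ha, Preadditive.sub_comp, Category.assoc,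
      Sigma.ι_π_of_ne Y (b := ⟨n + 1⟩) (c := ⟨0⟩) (by simp), comp_zero, sub_zero]
  have key1 : ∀ m, a ≫ Sigma.π Y ⟨m + 1⟩ = Sigma.π Y ⟨m + 1⟩ - Sigma.π Y ⟨m⟩ ≫ fs m := by
    intro m
    apply Sigma.hom_ext
    rintro ⟨n⟩
    rw [← Category.assoc, ha, Preadditive.sub_comp, Category.assoc, Preadditive.comp_sub]
    congr 1
    by_cases hnm : n = m
    · subst hnm
      rw [Sigma.ι_π_eq_id, Sigma.ι_π_eq_id_assoc, Category.comp_id]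
    · rw [Sigma.ι_π_of_ne Y (b := ⟨n + 1⟩) (c := ⟨m + 1⟩) (by simpa using hnm), comp_zero,
        ← Category.assoc, Sigma.ι_π_of_ne Y (b := ⟨n⟩) (c := ⟨m⟩) (by simpa using hnm), zero_comp]
  rintro ⟨n⟩
  have main : ∀ n : ℕ, h ≫ Sigma.π Y ⟨n⟩ = 0 := by
    intro n
    induction n with
    | zero => rw [← key0, ← Category.assoc, h0, zero_comp]
    | succ n ih =>
      have : h ≫ a ≫ Sigma.π Y ⟨n + 1⟩ = 0 := by rw [← Category.assoc, h0, zero_comp]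
      rw [key1, Preadditive.comp_sub, ← Category.assoc h, ih, zero_comp, sub_zero] at this
      exact this
  convert main n

lemma oneSubShift_inj' {C : T} (hC : IsCompactObj T C) (Y : ULift.{v} ℕ → T)
    (fs : ∀ n : ℕ, Y ⟨n⟩ ⟶ Y ⟨n + 1⟩) (a : (∐ Y) ⟶ ∐ Y)
    (ha : ∀ n : ℕ, Sigma.ι Y ⟨n⟩ ≫ a = Sigma.ι Y ⟨n⟩ - fs n ≫ Sigma.ι Y ⟨n + 1⟩)
    (h : C ⟶ (∐ Y)⟦(1 : ℤ)⟧) (h0 : h ≫ a⟦(1 : ℤ)⟧' = 0) : h = 0 := by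
  let e := shiftNegShift C (1 : ℤ)
  obtain ⟨h', hh'⟩ := (shiftFunctor T (1 : ℤ)).map_surjective (e.hom ≫ h)
  have : h' = 0 := by
    apply oneSubShift_inj (compact_shift hC (-1)) Y fs a ha
    apply (shiftFunctor T (1 : ℤ)).map_injective
    rw [Functor.map_comp, hh', Category.assoc, h0]
    simp
  rw [this] at hh'
  refine (cancel_epi e.hom).1 ?_
  rw [← hh']; simp

lemma eF_insert {J : Type v} [i : DecidableEq J] (f : J → T) (F : Finset J) (j : J)
    (hj : j ∉ F) :
    ∃ r : (∐ f) ⟶ f j, eF f (insert j F) = r ≫ Sigma.ι f j + eF f F := by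
  have e : i = fun a b => Classical.propDecidable (a = b) := Subsingleton.elim _ _
  subst e
  letI : DecidableEq J := fun a b => Classical.propDecidable (a = b)
  exact ⟨Sigma.π f j, Finset.sum_insert hj⟩

lemma CohFun.brown_gen {K : Type v} (G : K → T) (hG : ∀ k, IsCompactObj T (G k)) :
    ∃ (I : T) (x : H.obj I), ∀ k, H.Good x (G k) := by
  classical
  let J0 := Σ k : K, H.obj (G k)
  let F0 : J0 → T := fun j => G j.1
  obtain ⟨x0, hx0⟩ := (H.coprod F0).2 (fun j => j.2)
  choose nx nf nu hnu hnk using fun (p : Σ X : T, H.obj X) => H.step G p.1 p.2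
  let P : ℕ → Σ X : T, H.obj X := fun n => Nat.rec ⟨∐ F0, x0⟩ (fun _ p => ⟨nx p, nu p⟩) n
  let Y : ULift.{v} ℕ → T := fun n => (P n.down).1
  let fs : ∀ n : ℕ, Y ⟨n⟩ ⟶ Y ⟨n + 1⟩ := fun n => nf (P n)
  have hfs : ∀ n, H.map (fs n) (P (n + 1)).2 = (P n).2 := fun n => hnu (P n)
  have hkill : ∀ n k (h : G k ⟶ Y ⟨n⟩), H.map h (P n).2 = 0 → h ≫ fs n = 0 :=
    fun n => hnk (P n)
  let a : (∐ Y) ⟶ ∐ Y := Sigma.desc fun n => Sigma.ι Y n - fs n.down ≫ Sigma.ι Y ⟨n.down + 1⟩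
  have ha : ∀ n : ℕ, Sigma.ι Y ⟨n⟩ ≫ a = Sigma.ι Y ⟨n⟩ - fs n ≫ Sigma.ι Y ⟨n + 1⟩ :=
    fun n => Sigma.ι_desc _ _
  obtain ⟨w, hw⟩ := (H.coprod Y).2 (fun n => (P n.down).2)
  have hw' : ∀ n : ℕ, H.map (Sigma.ι Y ⟨n⟩) w = (P n).2 := fun n => congrFun hw ⟨n⟩
  obtain ⟨I, b, c, hT⟩ := distinguished_cocone_triangle a
  have hxe : ∃ x : H.obj I, H.map b x = w := H.exact _ hT w (by
    apply (H.coprod Y).1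
    funext ⟨n⟩
    change H.map (Sigma.ι Y ⟨n⟩) (H.map a w) = H.map (Sigma.ι Y ⟨n⟩) 0
    rw [_root_.map_zero, ← H.map_comp, ha, H.map_sub', H.map_comp, hw', hw', hfs, sub_self])
  obtain ⟨x, hx⟩ := hxe
  have hab : a ≫ b = 0 := comp_distTriang_mor_zero₁₂ _ hT
  have hstep : ∀ n : ℕ, Sigma.ι Y ⟨n⟩ ≫ b = fs n ≫ Sigma.ι Y ⟨n + 1⟩ ≫ b := by
    intro n
    have : Sigma.ι Y ⟨n⟩ ≫ a ≫ b = 0 := by rw [hab, comp_zero]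
    rw [← Category.assoc, ha, Preadditive.sub_comp, sub_eq_zero, Category.assoc] at this
    exact this
  have hsteps : ∀ n d : ℕ, ∃ t : Y ⟨n⟩ ⟶ Y ⟨n + d⟩, Sigma.ι Y ⟨n⟩ ≫ b = t ≫ Sigma.ι Y ⟨n + d⟩ ≫ b := by
    intro n d
    induction d with
    | zero => exact ⟨𝟙 _, by rw [Category.id_comp]; rfl⟩
    | succ d ih =>
      obtain ⟨t, ht⟩ := ih
      exact ⟨t ≫ fs (n + d), by rw [ht, hstep (n + d), Category.assoc]; rfl⟩
  have hsteps' : ∀ n m : ℕ, n ≤ m → ∃ t : Y ⟨n⟩ ⟶ Y ⟨m⟩, Sigma.ι Y ⟨n⟩ ≫ b = t ≫ Sigma.ι Y ⟨m⟩ ≫ b := by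
    intro n m hnm
    obtain ⟨d, rfl⟩ := Nat.exists_eq_add_of_le hnm
    exact hsteps n d
  refine ⟨I, x, fun k => H.good_mk ?_ ?_⟩
  · intro g hg
    have hgc : g ≫ c = 0 := by
      apply oneSubShift_inj' (hG k) Y fs a ha
      have : c ≫ a⟦(1 : ℤ)⟧' = 0 := comp_distTriang_mor_zero₃₁ _ hT
      rw [Category.assoc, this, comp_zero]
    obtain ⟨g', hg'⟩ := Triangle.coyoneda_exact₃ _ hT g hgc
    change G k ⟶ ∐ Y at g'
    change g = g' ≫ b at hg'
    obtain ⟨F, hF⟩ := (compact_iff _).1 (hG k) _ Y g'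
    have hfin : ∀ F : Finset (ULift.{v} ℕ), ∃ (N : ℕ) (m : G k ⟶ Y ⟨N⟩),
        g' ≫ eF Y F ≫ b = m ≫ Sigma.ι Y ⟨N⟩ ≫ b := by
      intro F
      induction F using Finset.induction_on with
      | empty => exact ⟨0, 0, by simp [eF]⟩
      | insert j F hj ih =>
        obtain ⟨N, m, hm⟩ := ih
        obtain ⟨t, ht⟩ := hsteps' N (max N j.down) (le_max_left _ _)
        obtain ⟨s, hs⟩ := hsteps' j.down (max N j.down) (le_max_right _ _)
        obtain ⟨r, e⟩ := eF_insert Y F j hj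
        refine ⟨max N j.down, m ≫ t + (g' ≫ r) ≫ s, ?_⟩
        rw [e, Preadditive.add_comp, Preadditive.comp_add, hm, ht, Preadditive.add_comp]
        simp only [Category.assoc]
        rw [← hs, add_comm]
    obtain ⟨N, m, hm⟩ := hfin F
    rw [← Category.assoc, hF, ← hg'] at hm
    have hm0 : H.map m (P N).2 = 0 := by
      rw [← hw' N, ← hx, ← H.map_comp, ← H.map_comp, Category.assoc, ← hm, hg]
    rw [hm, hstep, ← Category.assoc, hkill N k m hm0, zero_comp]
  · intro y
    let i0 : G k ⟶ Y ⟨0⟩ := Sigma.ι F0 ⟨k, y⟩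
    refine ⟨i0 ≫ Sigma.ι Y ⟨0⟩ ≫ b, ?_⟩
    rw [H.map_comp, H.map_comp, hx, hw' 0]
    exact congrFun hx0 ⟨k, y⟩

/-- Brown representability. -/
theorem CohFun.brown (hgen : CompactlyGen T) :
    ∃ (I : T) (x : H.obj I), ∀ X, H.Good x X := by
  obtain ⟨ι, g, hg, hloc⟩ := hgen
  obtain ⟨I, x, hx⟩ := H.brown_gen (K := ι × ℤ) (fun k => (g k.1)⟦k.2⟧)
    (fun k => compact_shift (hg k.1) k.2)
  have hS : IsLocalizing T {Y : T | ∀ n : ℤ, H.Good x (Y⟦n⟧)} := by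
    constructor
    · intro Y hY n
      exact H.good_zero ((shiftFunctor T n).map_isZero hY)
    · intro Y Z e hY n
      exact H.good_iso ((shiftFunctor T n).mapIso e) (hY n)
    · intro Y hY m n
      exact H.good_iso ((shiftFunctorAdd T m n).app Y) (hY (m + n))
    · intro Tr hTr h1 h2 n
      exact H.good_cone _ (Triangle.shift_distinguished Tr hTr n) (h1 n) (h2 n)
        (H.good_iso ((shiftFunctorAdd T n 1).app Tr.obj₁) (h1 (n + 1)))
        (H.good_iso ((shiftFunctorAdd T n 1).app Tr.obj₂) (h2 (n + 1)))
    · intro J f hf n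
      exact H.good_iso (PreservesCoproduct.iso (shiftFunctor T n) f).symm
        (H.good_coprod _ fun j => hf j n)
  refine ⟨I, x, fun X => ?_⟩
  have : X ∈ {Y : T | ∀ n : ℤ, H.Good x (Y⟦n⟧)} := by
    apply loc_le hS (A := Set.range g)
    · rintro _ ⟨i, rfl⟩ n
      exact hx (i, n)
    · rw [hloc]; trivial
  exact H.good_iso ((shiftFunctorZero T ℤ).app X) (this 0)

end Brown
end BIK

set_option linter.unusedSectionVars false
namespace BIK

section Act

variable {R : Type u} [Ring R] {𝒜 : ℤ → AddSubgroup R} [GradedRing 𝒜]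
variable {T : Type u'} [Category.{v} T] [HasZeroObject T] [Preadditive T] [HasShift T ℤ]
  [∀ n : ℤ, (CategoryTheory.shiftFunctor T n).Additive] [Pretriangulated T]
  [HasCoproducts.{v} T]

lemma exists_shift_lift {C X : T} (n : ℤ) (h : C ⟶ X⟦n⟧) :
    ∃ h' : C⟦-n⟧ ⟶ X, h = (shiftNegShift C n).inv ≫ h'⟦n⟧' := by
  obtain ⟨h', hh'⟩ := (shiftFunctor T n).map_surjective ((shiftNegShift C n).hom ≫ h)
  exact ⟨h', by rw [hh']; simp⟩

lemma coyo2 (Tr : Triangle T) (hTr : Tr ∈ distTriang T) (n : ℤ) {C : T} (h : C ⟶ Tr.obj₂⟦n⟧)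
    (h0 : h ≫ Tr.mor₂⟦n⟧' = 0) : ∃ g : C ⟶ Tr.obj₁⟦n⟧, h = g ≫ Tr.mor₁⟦n⟧' := by
  obtain ⟨h', rfl⟩ := exists_shift_lift n h
  rw [Category.assoc, ← Functor.map_comp] at h0
  have h1 : (h' ≫ Tr.mor₂)⟦n⟧' = 0 :=
    (cancel_epi (shiftNegShift C n).inv).1 (h0.trans comp_zero.symm)
  have h2 : h' ≫ Tr.mor₂ = 0 := (shiftFunctor T n).map_injective (by rw [h1]; simp)
  obtain ⟨g, hg⟩ := Triangle.coyoneda_exact₂ Tr hTr h' h2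
  exact ⟨(shiftNegShift C n).inv ≫ g⟦n⟧', by
    rw [hg, Functor.map_comp]; exact (Category.assoc _ _ _).symm⟩

lemma coyo3 (Tr : Triangle T) (hTr : Tr ∈ distTriang T) (n : ℤ) {C : T} (h : C ⟶ Tr.obj₃⟦n⟧)
    (h0 : h ≫ Tr.mor₃⟦n⟧' = 0) : ∃ g : C ⟶ Tr.obj₂⟦n⟧, h = g ≫ Tr.mor₂⟦n⟧' :=
  coyo2 _ (rot_of_distTriang _ hTr) n h h0

namespace CenterAction

variable (A : CenterAction 𝒜 T)

lemma act_zero (i : ℤ) (h : (0 : R) ∈ 𝒜 i) (X : T) : A.act i 0 h X = 0 := by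
  have := A.act_add i 0 0 h h X
  simp only [add_zero] at this
  exact left_eq_add.mp this

lemma act_congr {i j : ℤ} {a b : R} (hij : i = j) (hab : a = b) (ha : a ∈ 𝒜 i) (hb : b ∈ 𝒜 j)
    {C X : T} (f : C ⟶ X) : f ≫ A.act i a ha X = 0 ↔ f ≫ A.act j b hb X = 0 := by
  subst hij; subst hab; rfl

lemma kill_mul_left {i j : ℤ} {a b : R} (ha : a ∈ 𝒜 i) (hb : b ∈ 𝒜 j) {C X : T} (f : C ⟶ X)
    (h : f ≫ A.act j b hb X = 0) :
    f ≫ A.act (i + j) (a * b) (SetLike.mul_mem_graded ha hb) X = 0 := by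
  rw [A.act_mul i j a b ha hb X, ← Category.assoc, h, zero_comp]

lemma kill_mul_right {i j : ℤ} {a b : R} (ha : a ∈ 𝒜 i) (hb : b ∈ 𝒜 j) {C X : T} (f : C ⟶ X)
    (h : f ≫ A.act i a ha X = 0) :
    f ≫ A.act (i + j) (a * b) (SetLike.mul_mem_graded ha hb) X = 0 := by
  rw [A.act_mul i j a b ha hb X, ← Category.assoc (A.act j b hb X), A.act_natural i a ha, ← Category.assoc,
    ← Category.assoc, h, zero_comp, zero_comp]

lemma kill_mul_comp {i j : ℤ} {a b : R} (ha : a ∈ 𝒜 i) (hb : b ∈ 𝒜 j) {C X : T} (f : C ⟶ X)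
    (h : f ≫ A.act j b hb X ≫ A.act i a ha (X⟦j⟧) = 0) :
    f ≫ A.act (i + j) (a * b) (SetLike.mul_mem_graded ha hb) X = 0 := by
  rw [A.act_mul i j a b ha hb X, ← Category.assoc (A.act j b hb X), ← Category.assoc, h, zero_comp]

lemma kill_post {i : ℤ} {a : R} (ha : a ∈ 𝒜 i) {C X Y : T} (f : C ⟶ X) (g : X ⟶ Y)
    (h : f ≫ A.act i a ha X = 0) : (f ≫ g) ≫ A.act i a ha Y = 0 := by
  rw [Category.assoc, A.act_natural, ← Category.assoc, h, zero_comp]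

lemma kill_pre {i : ℤ} {a : R} (ha : a ∈ 𝒜 i) {C X Y : T} (f : C ⟶ X) (g : X ⟶ Y)
    (h : g ≫ A.act i a ha Y = 0) : (f ≫ g) ≫ A.act i a ha Y = 0 := by
  rw [Category.assoc, h, comp_zero]

lemma kill_shift {i : ℤ} {a : R} (ha : a ∈ 𝒜 i) {C X : T} (f : C ⟶ X) (n : ℤ)
    (h : f ≫ A.act i a ha X = 0) : f⟦n⟧' ≫ A.act i a ha (X⟦n⟧) = 0 := by
  rw [A.act_shift, Preadditive.comp_zsmul, ← Category.assoc, ← Functor.map_comp, h,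
    Functor.map_zero, zero_comp, smul_zero]

lemma ann_shift {i : ℤ} {a : R} (ha : a ∈ 𝒜 i) {X : T} (n : ℤ)
    (h : A.act i a ha X = 0) : A.act i a ha (X⟦n⟧) = 0 := by
  rw [A.act_shift, h, Functor.map_zero, zero_comp, smul_zero]

/-- The action of a homogeneous element commutes with its own degree shift. -/
lemma act_shift_self {i : ℤ} {a : R} (ha : a ∈ 𝒜 i) (X : T) :
    A.act i a ha (X⟦i⟧) = ((-1 : ℤ) ^ (i * i).natAbs) • (A.act i a ha X)⟦i⟧' := by
  rw [A.act_shift]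
  congr 1
  have : (shiftComm X i i).hom = 𝟙 _ := by
    rw [shiftComm, shiftFunctorComm_eq T i i (i + i) rfl]
    simp
  rw [this]; exact Category.comp_id _

/-- If `s` kills the first and `s'` the second object of a triangle, the product kills the
third. -/
lemma ann_cone (Tr : Triangle T) (hTr : Tr ∈ distTriang T) {i j : ℤ} {a b : R}
    (ha : a ∈ 𝒜 i) (hb : b ∈ 𝒜 j) (h1 : A.act j b hb Tr.obj₁ = 0)
    (h2 : A.act i a ha Tr.obj₂ = 0) :
    A.act (i + j) (a * b) (SetLike.mul_mem_graded ha hb) Tr.obj₃ = 0 := by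
  obtain ⟨g, hg⟩ := coyo3 Tr hTr j (A.act j b hb Tr.obj₃) (by
    rw [← A.act_natural, A.ann_shift hb 1 h1, comp_zero])
  have := A.kill_mul_comp ha hb (𝟙 Tr.obj₃) (by
    rw [Category.id_comp, hg, Category.assoc, A.act_natural, A.ann_shift ha j h2, zero_comp,
      comp_zero])
  simpa using this

/-- On the cone of `s`, the square of `s` vanishes. -/
lemma ann_koszul {i : ℤ} {a : R} (ha : a ∈ 𝒜 i) {X N : T} (w : X⟦i⟧ ⟶ N) (d : N ⟶ X⟦(1 : ℤ)⟧)
    (hTr : Triangle.mk (A.act i a ha X) w d ∈ distTriang T) :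
    A.act (i + i) (a * a) (SetLike.mul_mem_graded ha ha) N = 0 := by
  have hd : d ≫ (A.act i a ha X)⟦(1 : ℤ)⟧' = 0 := comp_distTriang_mor_zero₃₁ _ hTr
  have hw : A.act i a ha X ≫ w = 0 := comp_distTriang_mor_zero₁₂ _ hTr
  have hex : ∃ g : N ⟶ (X⟦i⟧)⟦i⟧, A.act i a ha N = g ≫ w⟦i⟧' :=
    coyo3 _ hTr i (A.act i a ha N) (by
      change A.act i a ha N ≫ d⟦i⟧' = 0
      rw [← A.act_natural, A.act_shift, Preadditive.comp_zsmul, ← Category.assoc, hd, zero_comp,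
        smul_zero])
  obtain ⟨g, hg⟩ := hex
  have hw2 : w ≫ A.act i a ha N = 0 := by
    rw [A.act_natural, A.act_shift_self, Preadditive.zsmul_comp, ← Functor.map_comp, hw,
      Functor.map_zero, smul_zero]
  have := A.kill_mul_comp ha ha (𝟙 N) (by
    rw [Category.id_comp]
    conv_lhs => rw [hg]
    rw [Category.assoc, A.kill_shift ha w i hw2, comp_zero])
  simpa using this

/-- A map is killed by a homogeneous element outside of `p`. -/
def KillOut (p : SpecR 𝒜) {C X : T} (f : C ⟶ X) : Prop :=
  ∃ (i : ℤ) (s : R) (hs : s ∈ 𝒜 i), s ∉ p.1.toIdeal ∧ f ≫ A.act i s hs X = 0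

variable {A}

lemma mul_not_mem {p : SpecR 𝒜} {i j : ℤ} {a b : R} (ha : a ∈ 𝒜 i) (hb : b ∈ 𝒜 j)
    (hap : a ∉ p.1.toIdeal) (hbp : b ∉ p.1.toIdeal) : a * b ∉ p.1.toIdeal := fun h =>
  (p.2.mem_or_mem ha hb h).elim hap hbp

lemma one_not_mem (p : SpecR 𝒜) : (1 : R) ∉ p.1.toIdeal := fun h =>
  p.2.ne_top ((Ideal.eq_top_iff_one _).2 h)

lemma pow_not_mem {p : SpecR 𝒜} {i : ℤ} {a : R} (ha : a ∈ 𝒜 i) (hap : a ∉ p.1.toIdeal) (n : ℕ) :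
    a ^ n ∉ p.1.toIdeal := by
  induction n with
  | zero => rw [pow_zero]; exact one_not_mem p
  | succ n ih => rw [pow_succ]; exact mul_not_mem (SetLike.pow_mem_graded n ha) ha ih hap

lemma KillOut.zero (p : SpecR 𝒜) {C X : T} : A.KillOut p (0 : C ⟶ X) :=
  ⟨0, 1, SetLike.one_mem_graded 𝒜, one_not_mem p, zero_comp⟩

lemma KillOut.add {p : SpecR 𝒜} {C X : T} {f g : C ⟶ X} (hf : A.KillOut p f)
    (hg : A.KillOut p g) : A.KillOut p (f + g) := by
  obtain ⟨i, s, hs, hsp, h⟩ := hf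
  obtain ⟨j, t, ht, htp, h'⟩ := hg
  refine ⟨i + j, s * t, SetLike.mul_mem_graded hs ht, mul_not_mem hs ht hsp htp, ?_⟩
  rw [Preadditive.add_comp, A.kill_mul_right hs ht f h, A.kill_mul_left hs ht g h', add_zero]

lemma KillOut.sum {p : SpecR 𝒜} {C X : T} {J : Type*} (F : Finset J) (f : J → (C ⟶ X))
    (hf : ∀ j ∈ F, A.KillOut p (f j)) : A.KillOut p (∑ j ∈ F, f j) := by
  classical
  induction F using Finset.induction_on with
  | empty => simpa using KillOut.zero p
  | insert j F hj ih =>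
    rw [Finset.sum_insert hj]
    exact (hf j (by simp)).add (ih fun k hk => hf k (by simp [hk]))

lemma KillOut.pre {p : SpecR 𝒜} {C X Y : T} (f : C ⟶ X) {g : X ⟶ Y} (hg : A.KillOut p g) :
    A.KillOut p (f ≫ g) := by
  obtain ⟨i, s, hs, hsp, h⟩ := hg
  exact ⟨i, s, hs, hsp, A.kill_pre hs f g h⟩

lemma KillOut.post {p : SpecR 𝒜} {C X Y : T} {f : C ⟶ X} (hf : A.KillOut p f) (g : X ⟶ Y) :
    A.KillOut p (f ≫ g) := by
  obtain ⟨i, s, hs, hsp, h⟩ := hf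
  exact ⟨i, s, hs, hsp, A.kill_post hs f g h⟩

lemma KillOut.shift {p : SpecR 𝒜} {C X : T} {f : C ⟶ X} (hf : A.KillOut p f) (n : ℤ) :
    A.KillOut p (f⟦n⟧') := by
  obtain ⟨i, s, hs, hsp, h⟩ := hf
  exact ⟨i, s, hs, hsp, A.kill_shift hs f n h⟩

lemma KillOut.mono {p q : SpecR 𝒜} (hpq : p.1.toIdeal ≤ q.1.toIdeal) {C X : T} {f : C ⟶ X}
    (hf : A.KillOut q f) : A.KillOut p f := by
  obtain ⟨i, s, hs, hsp, h⟩ := hf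
  exact ⟨i, s, hs, fun h' => hsp (hpq h'), h⟩

lemma locVanishes_iff {p : SpecR 𝒜} {C X : T} :
    LocVanishes A p C X ↔ ∀ (n : ℤ) (f : C ⟶ X⟦n⟧), A.KillOut p f := by
  refine forall₂_congr fun n f => exists₃_congr fun i s hs => and_congr_right fun _ => ?_
  unfold CenterAction.hsmul
  constructor
  · intro h
    rw [← Category.assoc] at h
    exact (cancel_mono _).1 (h.trans zero_comp.symm)
  · intro h
    rw [← Category.assoc, h, zero_comp]

lemma mem_TV_iff {V : Set (SpecR 𝒜)} {X : T} : X ∈ TVset T A V ↔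
    ∀ C : T, IsCompactObj T C → ∀ p : SpecR 𝒜, p ∉ V → ∀ f : C ⟶ X, A.KillOut p f := by
  constructor
  · intro h C hC p hp f
    have := locVanishes_iff.1 (h C hC p hp) 0 (f ≫ (shiftFunctorZero T ℤ).inv.app X)
    have h2 := this.post ((shiftFunctorZero T ℤ).hom.app X)
    simpa using h2
  · intro h C hC p hp
    rw [locVanishes_iff]
    intro n f
    obtain ⟨f', rfl⟩ := exists_shift_lift n f
    exact ((h _ (compact_shift hC _) p hp f').shift n).pre _

variable (A) in
lemma TV_localizing (V : Set (SpecR 𝒜)) : IsLocalizing T (TVset T A V) := by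
  have hsh : ∀ X ∈ TVset T A V, ∀ n : ℤ, X⟦n⟧ ∈ TVset T A V := by
    intro X hX n
    rw [mem_TV_iff]
    intro C hC p hp f
    exact locVanishes_iff.1 (hX C hC p hp) n f
  constructor
  · intro X hX
    rw [mem_TV_iff]
    intro C hC p hp f
    rw [hX.eq_of_tgt f 0]
    exact KillOut.zero p
  · intro X Y e hX
    rw [mem_TV_iff] at *
    intro C hC p hp f
    simpa using (hX C hC p hp (f ≫ e.inv)).post e.hom
  · exact hsh
  · intro Tr hTr h1 h2
    have h1' := hsh _ h1 1
    rw [mem_TV_iff] at h1' ⊢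
    intro C hC p hp f
    obtain ⟨i, s, hs, hsp, h⟩ := h1' C hC p hp (f ≫ Tr.mor₃)
    rw [Category.assoc, A.act_natural, ← Category.assoc] at h
    obtain ⟨g, hg⟩ := coyo3 Tr hTr i _ h
    obtain ⟨j, t, ht, htp, h'⟩ := mem_TV_iff.1 (hsh _ h2 i) C hC p hp g
    refine ⟨j + i, t * s, SetLike.mul_mem_graded ht hs, mul_not_mem ht hs htp hsp, ?_⟩
    apply A.kill_mul_comp ht hs
    rw [← Category.assoc, hg]
    exact A.kill_post ht g _ h'
  · intro J f hf
    simp only [mem_TV_iff] at *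
    intro C hC p hp g
    obtain ⟨F, hF⟩ := (compact_iff C).1 hC J f g
    rw [← hF, eF, Preadditive.comp_sum]
    refine KillOut.sum _ _ fun j _ => ?_
    rw [← Category.assoc]
    exact (hf j C hC p hp _).post _

lemma TV_mono {V W : Set (SpecR 𝒜)} (h : V ⊆ W) : TVset T A V ⊆ TVset T A W := by
  intro X hX C hC p hp
  exact hX C hC p (fun h' => hp (h h'))

lemma specClosed_Z (q : SpecR 𝒜) : SpecClosed (Zset q) := fun _ _ hp hpq h => hp (hpq.trans h)

lemma specClosed_V (q : SpecR 𝒜) : SpecClosed (Vp q) := fun _ _ hp hpq => hp.trans hpq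

lemma mem_TZ_iff {q : SpecR 𝒜} {X : T} : X ∈ TVset T A (Zset q) ↔
    ∀ C : T, IsCompactObj T C → ∀ f : C ⟶ X, A.KillOut q f := by
  rw [mem_TV_iff]
  constructor
  · intro h C hC f
    exact h C hC q (by simp [Zset]) f
  · intro h C hC p hp f
    refine (h C hC f).mono ?_
    by_contra h'
    exact hp h'

variable (A) in
/-- Objects admitting no maps from `q`-locally trivial compact objects. -/
def PSet (q : SpecR 𝒜) : Set T :=
  {X | ∀ N : T, IsCompactObj T N →
    (∃ (i : ℤ) (s : R) (hs : s ∈ 𝒜 i), s ∉ q.1.toIdeal ∧ A.act i s hs N = 0) →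
    ∀ (n : ℤ) (f : N ⟶ X⟦n⟧), f = 0}

/-- Objects receiving no maps from a compact object form a localizing subcategory. -/
lemma perp_localizing {D : T} (hD : IsCompactObj T D) :
    IsLocalizing T {X : T | ∀ (n : ℤ) (f : D ⟶ X⟦n⟧), f = 0} := by
  have hsh : ∀ X ∈ {X : T | ∀ (n : ℤ) (f : D ⟶ X⟦n⟧), f = 0}, ∀ n : ℤ,
      X⟦n⟧ ∈ {X : T | ∀ (n : ℤ) (f : D ⟶ X⟦n⟧), f = 0} := by
    intro X hX m n f
    have := hX (m + n) (f ≫ (shiftFunctorAdd T m n).inv.app X)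
    exact (cancel_mono ((shiftFunctorAdd T m n).inv.app X)).1 (this.trans zero_comp.symm)
  constructor
  · intro X hX n f
    exact ((shiftFunctor T n).map_isZero hX).eq_of_tgt _ _
  · intro X Y e hX n f
    have := hX n (f ≫ e.inv⟦n⟧')
    exact (cancel_mono (e.inv⟦n⟧')).1 (this.trans zero_comp.symm)
  · exact hsh
  · intro Tr hTr h1 h2 n f
    obtain ⟨g, hg⟩ := coyo3 Tr hTr n f (hsh _ h1 1 n _)
    rw [hg, h2 n g, zero_comp]
  · intro J f hf n g
    obtain ⟨F, hF⟩ := compact_shift_fac hD f n g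
    rw [← hF, eF, Functor.map_sum, Preadditive.comp_sum]
    refine Finset.sum_eq_zero fun j _ => ?_
    rw [Functor.map_comp, ← Category.assoc, hf j n (g ≫ _), zero_comp]

variable (A) in
lemma PSet_localizing (q : SpecR 𝒜) : IsLocalizing T (A.PSet q) := by
  constructor
  · intro X hX N hN h
    exact (perp_localizing hN).zero_mem X hX
  · intro X Y e hX N hN h
    exact (perp_localizing hN).iso_mem e (hX N hN h)
  · intro X hX n N hN h
    exact (perp_localizing hN).shift_mem X (hX N hN h) n
  · intro Tr hTr h1 h2 N hN h
    exact (perp_localizing hN).ext_mem Tr hTr (h1 N hN h) (h2 N hN h)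
  · intro J f hf N hN h
    exact (perp_localizing hN).coprod_mem J f fun j => hf j N hN h

lemma PSet_inter (hgen : CompactlyGen T) {q : SpecR 𝒜} {X : T} (h : X ∈ A.PSet q)
    (h' : X ∈ TVset T A (Zset q)) : IsZero X := by
  apply isZero_of_compact hgen
  intro C hC f
  obtain ⟨i, s, hs, hsq, hf⟩ := mem_TZ_iff.1 h' C hC f
  obtain ⟨N, w, d, hTr⟩ := distinguished_cocone_triangle (A.act i s hs C)
  have hN : IsCompactObj T N := compact_cone _ hTr hC (compact_shift hC i)
  rw [A.act_natural] at hf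
  have hex : ∃ g : N ⟶ X⟦i⟧, f⟦i⟧' = w ≫ g := Triangle.yoneda_exact₂ _ hTr (f⟦i⟧') hf
  obtain ⟨g, hg⟩ := hex
  have : g = 0 := h N hN ⟨_, _, _, mul_not_mem hs hs hsq hsq, A.ann_koszul hs w d hTr⟩ i g
  rw [this, comp_zero] at hg
  exact (shiftFunctor T i).map_injective (by rw [hg]; simp)

lemma mem_TZ_of_ann {q : SpecR 𝒜} {N : T}
    (h : ∃ (i : ℤ) (s : R) (hs : s ∈ 𝒜 i), s ∉ q.1.toIdeal ∧ A.act i s hs N = 0) :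
    N ∈ TVset T A (Zset q) := by
  obtain ⟨i, s, hs, hsq, h⟩ := h
  rw [mem_TZ_iff]
  intro C hC f
  exact ⟨i, s, hs, hsq, by rw [h, comp_zero]⟩

lemma perp_sub_PSet {q : SpecR 𝒜} {X : T}
    (h : ∀ W ∈ TVset T A (Zset q), ∀ f : W ⟶ X, f = 0) : X ∈ A.PSet q := by
  intro N hN hs n f
  obtain ⟨f', rfl⟩ := exists_shift_lift n f
  rw [h _ ((TV_localizing A _).shift_mem _ (mem_TZ_of_ann hs) (-n)) f', Functor.map_zero]
  exact comp_zero

lemma V_sub_Z {p q : SpecR 𝒜} (h : ¬ p.1.toIdeal ≤ q.1.toIdeal) : Vp p ⊆ Zset q :=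
  fun _ hr hrq => h (le_trans hr hrq)

/-- An ideal inclusion fails on a homogeneous element. -/
lemma exists_hom_not_mem {p q : SpecR 𝒜} (h : ¬ p.1.toIdeal ≤ q.1.toIdeal) :
    ∃ (i : ℤ) (a : R), a ∈ 𝒜 i ∧ a ∈ p.1.toIdeal ∧ a ∉ q.1.toIdeal := by
  classical
  by_contra hcon
  push Not at hcon
  apply h
  intro r hr
  rw [← DirectSum.sum_support_decompose 𝒜 r]
  refine Ideal.sum_mem _ fun i _ => ?_
  exact hcon i _ (SetLike.coe_mem _) (p.1.isHomogeneous i hr)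

end CenterAction

end Act
end BIK

set_option linter.unusedSectionVars false
namespace BIK

section HMsec

variable {R : Type u} [Ring R] {𝒜 : ℤ → AddSubgroup R} [GradedRing 𝒜]
variable {T : Type u'} [Category.{v} T] [HasZeroObject T] [Preadditive T] [HasShift T ℤ]
  [∀ n : ℤ, (CategoryTheory.shiftFunctor T n).Additive] [Pretriangulated T]
  [HasCoproducts.{v} T]

namespace CenterAction

variable (A : CenterAction 𝒜 T)

/-- The total graded Hom group. -/
def HM (_ : CenterAction 𝒜 T) (C X : T) : Type v := DirectSum ℤ fun n => (C ⟶ X⟦n⟧)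

noncomputable instance (C X : T) : AddCommGroup (A.HM C X) :=
  inferInstanceAs (AddCommGroup (DirectSum ℤ fun n => (C ⟶ X⟦n⟧)))

/-- Homogeneous elements. -/
noncomputable def hof {C X : T} (n : ℤ) : (C ⟶ X⟦n⟧) →+ A.HM C X :=
  DirectSum.of (fun n => (C ⟶ X⟦n⟧)) n

/-- Universal property of `HM`. -/
noncomputable def hlift {C X : T} {M : Type*} [AddCommGroup M]
    (φ : ∀ n : ℤ, (C ⟶ X⟦n⟧) →+ M) : A.HM C X →+ M :=
  DirectSum.toAddMonoid φ

@[simp] lemma hlift_hof {C X : T} {M : Type*} [AddCommGroup M]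
    (φ : ∀ n : ℤ, (C ⟶ X⟦n⟧) →+ M) (n : ℤ) (f : C ⟶ X⟦n⟧) :
    A.hlift φ (A.hof n f) = φ n f := DirectSum.toAddMonoid_of _ _ _

/-- Components. -/
def hcomp {C X : T} (n : ℤ) : A.HM C X →+ (C ⟶ X⟦n⟧) :=
  DFinsupp.evalAddMonoidHom n

lemma hcomp_hof {C X : T} (n : ℤ) (f : C ⟶ X⟦n⟧) : A.hcomp n (A.hof n f) = f :=
  DirectSum.of_eq_same _ _

lemma hcomp_hof_ne {C X : T} {n m : ℤ} (h : m ≠ n) (f : C ⟶ X⟦n⟧) :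
    A.hcomp m (A.hof n f) = 0 :=
  DirectSum.of_eq_of_ne _ _ _ h

variable {A} in
lemma HM.induction {C X : T} {P : A.HM C X → Prop} (h : A.HM C X) (h0 : P 0)
    (h1 : ∀ n f, P (A.hof n f)) (h2 : ∀ x y, P x → P y → P (x + y)) : P h :=
  DirectSum.induction_on (motive := P) h h0 h1 h2

lemma hom_sum {C X : T} (h : A.HM C X) : ∃ F : Finset ℤ, h = ∑ n ∈ F, A.hof n (A.hcomp n h) := by
  classical
  exact ⟨_, (DirectSum.sum_support_of (h : DirectSum ℤ fun n => (C ⟶ X⟦n⟧))).symm⟩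

lemma hof_hsmul {i : ℤ} {a : R} (ha : a ∈ 𝒜 i) {C X : T} {n m : ℤ} (h : n + i = m)
    (f : C ⟶ X⟦n⟧) : A.hof (n + i) (A.hsmul ha f)
      = A.hof m (f ≫ A.act i a ha (X⟦n⟧) ≫ (shiftFunctorAdd' T n i m h).inv.app X) := by
  subst h; rfl

lemma hsmul_add {i : ℤ} {a : R} (ha : a ∈ 𝒜 i) {C X : T} {n : ℤ} (f g : C ⟶ X⟦n⟧) :
    A.hsmul ha (f + g) = A.hsmul ha f + A.hsmul ha g := by
  unfold CenterAction.hsmul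
  rw [Preadditive.add_comp]

lemma add_hsmul {i : ℤ} {a b : R} (ha : a ∈ 𝒜 i) (hb : b ∈ 𝒜 i) {C X : T} {n : ℤ}
    (f : C ⟶ X⟦n⟧) :
    A.hsmul (add_mem ha hb) f = A.hsmul ha f + A.hsmul hb f := by
  unfold CenterAction.hsmul
  rw [A.act_add, Preadditive.add_comp, Preadditive.comp_add]

/-- The action of a homogeneous element. -/
noncomputable def hactOne (C X : T) {i : ℤ} {a : R} (ha : a ∈ 𝒜 i) : A.HM C X →+ A.HM C X :=
  A.hlift fun n => (A.hof (n + i)).comp (AddMonoidHom.mk' (fun f => A.hsmul ha f) (A.hsmul_add ha))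

lemma hactOne_hof (C X : T) {i : ℤ} {a : R} (ha : a ∈ 𝒜 i) (n : ℤ) (f : C ⟶ X⟦n⟧) :
    A.hactOne C X ha (A.hof n f) = A.hof (n + i) (A.hsmul ha f) := by
  unfold hactOne
  rw [hlift_hof]; rfl

lemma HM_hom_ext {C X : T} {M : Type*} [AddCommGroup M] {φ ψ : A.HM C X →+ M}
    (h : ∀ n f, φ (A.hof n f) = ψ (A.hof n f)) : φ = ψ := by
  refine AddMonoidHom.ext fun x => ?_
  induction x using HM.induction with
  | h0 => rw [map_zero, map_zero]
  | h1 n f => exact h n f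
  | h2 x y hx hy => rw [map_add, map_add, hx, hy]

lemma hactOne_add (C X : T) {i : ℤ} {a b : R} (ha : a ∈ 𝒜 i) (hb : b ∈ 𝒜 i) :
    A.hactOne C X (add_mem ha hb) = A.hactOne C X ha + A.hactOne C X hb := by
  refine A.HM_hom_ext fun n f => ?_
  rw [AddMonoidHom.add_apply, hactOne_hof, hactOne_hof, hactOne_hof, A.add_hsmul ha hb, map_add]

/-- The action of homogeneous elements, additively. -/
noncomputable def hact (C X : T) (i : ℤ) : 𝒜 i →+ AddMonoid.End (A.HM C X) :=
  AddMonoidHom.mk' (fun a => (A.hactOne C X a.2 : A.HM C X →+ A.HM C X))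
    fun a b => A.hactOne_add C X a.2 b.2

lemma hact_hof (C X : T) {i : ℤ} {a : R} (ha : a ∈ 𝒜 i) (n : ℤ) (f : C ⟶ X⟦n⟧) :
    A.hact C X i ⟨a, ha⟩ (A.hof n f) = A.hof (n + i) (A.hsmul ha f) := by
  exact A.hactOne_hof C X ha n f

/-- The additive map defining the `R`-module structure. -/
noncomputable def hactR (C X : T) : R →+ AddMonoid.End (A.HM C X) :=
  (DirectSum.toAddMonoid (A.hact C X)).comp
    (DirectSum.decomposeAddEquiv 𝒜).toAddMonoidHom

lemma hactR_hom (C X : T) {i : ℤ} {a : R} (ha : a ∈ 𝒜 i) :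
    A.hactR C X a = A.hact C X i ⟨a, ha⟩ := by
  change DirectSum.toAddMonoid (A.hact C X) (DirectSum.decompose 𝒜 a) = _
  rw [DirectSum.decompose_of_mem 𝒜 ha, DirectSum.toAddMonoid_of]

lemma hactR_hof (C X : T) {i : ℤ} {a : R} (ha : a ∈ 𝒜 i) (n : ℤ) (f : C ⟶ X⟦n⟧) :
    A.hactR C X a (A.hof n f) = A.hof (n + i) (A.hsmul ha f) := by
  rw [A.hactR_hom C X ha, hact_hof]

/-- The ring homomorphism defining the `R`-module structure. -/
noncomputable def θ (C X : T) : R →+* AddMonoid.End (A.HM C X) where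
  toFun := A.hactR C X
  map_zero' := map_zero _
  map_add' := map_add _
  map_one' := by
    ext h
    induction h using HM.induction with
    | h0 => simp
    | h1 n f =>
      rw [A.hactR_hof C X (SetLike.one_mem_graded 𝒜), A.hof_hsmul _ (add_zero n), A.act_one,
        shiftFunctorAdd'_add_zero_inv_app]
      simp
    | h2 x y hx hy => rw [map_add, map_add, hx, hy]
  map_mul' r s := by
    ext h
    induction h using HM.induction with
    | h0 => simp
    | h2 x y hx hy => rw [map_add, map_add, hx, hy]
    | h1 n f =>
      change _ = A.hactR C X r (A.hactR C X s (A.hof n f))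
      induction r using DirectSum.Decomposition.inductionOn 𝒜 with
      | zero => simp
      | add a b ha hb => 
        rw [add_mul, map_add, map_add]
        exact congrArg₂ (· + ·) ha hb
      | @homogeneous i a =>
        induction s using DirectSum.Decomposition.inductionOn 𝒜 with
        | zero => simp
        | add b c hb hc =>
          rw [mul_add, map_add, map_add]
          refine (congrArg₂ (· + ·) hb hc).trans ?_
          exact (map_add (A.hactR C X (a : R)) _ _).symm
        | @homogeneous j b =>
          rw [A.hactR_hof C X b.2, A.hactR_hof C X a.2,
            A.hactR_hof C X (SetLike.mul_mem_graded a.2 b.2),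
            A.hof_hsmul (SetLike.mul_mem_graded a.2 b.2) (m := n + j + i) (by ring)]
          congr 1
          unfold CenterAction.hsmul
          rw [A.act_mul i j a b a.2 b.2]
          have h1 := A.act_natural i (a : R) a.2
            ((shiftFunctorAdd' T n j (n + j) rfl).inv.app X)
          have h2 := shiftFunctorAdd'_assoc_inv_app (C := T) n j i (n + j) (i + j) (n + j + i) rfl
            (by ring) rfl X
          simp only [Category.assoc]
          rw [reassoc_of% h1, h2]

noncomputable instance (C X : T) : Module R (A.HM C X) := Module.compHom _ (A.θ C X)

lemma smul_hof (C X : T) {i : ℤ} {a : R} (ha : a ∈ 𝒜 i) (n : ℤ) (f : C ⟶ X⟦n⟧) :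
    a • (A.hof n f) = A.hof (n + i) (A.hsmul ha f) := A.hactR_hof C X ha n f

lemma smul_hof_eq_zero {C X : T} {i : ℤ} {a : R} (ha : a ∈ 𝒜 i) {n : ℤ} {f : C ⟶ X⟦n⟧} :
    a • (A.hof n f) = 0 ↔ f ≫ A.act i a ha (X⟦n⟧) = 0 := by
  rw [A.smul_hof C X ha]
  unfold CenterAction.hsmul
  constructor
  · intro h
    have := congrArg (A.hcomp (n + i)) h
    rw [hcomp_hof, map_zero, ← Category.assoc] at this
    exact (cancel_mono _).1 (this.trans zero_comp.symm)
  · intro h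
    rw [← Category.assoc, h, zero_comp, map_zero]

/-- If `r` kills a homogeneous element then so do its components. -/
lemma comp_smul_hof {C X : T} {r : R} {n : ℤ} {f : C ⟶ X⟦n⟧} (h : r • (A.hof n f) = 0) (i : ℤ) :
    (DirectSum.decompose 𝒜 r i : R) • (A.hof n f) = 0 := by
  classical
  have hc : ∀ s : R, A.hcomp (n + i) (s • A.hof n f) =
      A.hsmul (DirectSum.decompose 𝒜 s i).2 f := by
    intro s
    induction s using DirectSum.Decomposition.inductionOn 𝒜 with
    | zero => simp [CenterAction.hsmul, act_zero]
    | @homogeneous j b =>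
      rw [A.smul_hof C X b.2]
      by_cases hij : j = i
      · subst hij
        rw [hcomp_hof]
        simp
      · rw [hcomp_hof_ne _ (by intro h; apply hij; omega)]
        have : ((DirectSum.decompose 𝒜 (b : R) i : 𝒜 i) : R) = 0 :=
          DirectSum.decompose_of_mem_ne 𝒜 b.2 hij
        simp only [this, CenterAction.hsmul, act_zero, zero_comp, comp_zero]
    | add b c hb hc =>
      rw [add_smul, map_add, hb, hc]
      simp [CenterAction.hsmul, act_add]
  have := hc r
  rw [h, map_zero] at this
  rw [A.smul_hof C X (DirectSum.decompose 𝒜 r i).2, ← this, map_zero]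

/-- The `v`-small quotient of `R` acting on everything. -/
noncomputable abbrev RR (C : T) : Subring (AddMonoid.End (A.HM C C)) := (A.θ C C).range

/-- The quotient map. -/
noncomputable def rho (C : T) : R →+* A.RR C := (A.θ C C).rangeRestrict

lemma rho_surj (C : T) : Function.Surjective (A.rho C) := (A.θ C C).rangeRestrict_surjective

lemma ker_le (C X : T) : RingHom.ker (A.rho C) ≤ RingHom.ker (A.θ C X) := by
  classical
  intro r hr
  have h0 : A.θ C C r = 0 := congrArg Subtype.val hr
  have h1 : r • A.hof 0 ((shiftFunctorZero T ℤ).inv.app C) = 0 := by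
    change A.θ C C r _ = 0
    rw [h0]; rfl
  have h2 : ∀ i, A.act i (DirectSum.decompose 𝒜 r i : R) (DirectSum.decompose 𝒜 r i).2 C = 0 := by
    intro i
    have := (A.smul_hof_eq_zero (DirectSum.decompose 𝒜 r i).2).1 (A.comp_smul_hof h1 i)
    rw [A.act_natural] at this
    exact (cancel_mono _).1 (this.trans zero_comp.symm)
  have h3 : ∀ h : A.HM C X, r • h = 0 := by
    intro h
    induction h using HM.induction with
    | h0 => simp
    | h2 x y hx hy => rw [smul_add, hx, hy, add_zero]
    | h1 n f =>
      rw [← DirectSum.sum_support_decompose 𝒜 r, Finset.sum_smul]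
      refine Finset.sum_eq_zero fun i _ => ?_
      rw [A.smul_hof_eq_zero (DirectSum.decompose 𝒜 r i).2, A.act_natural, h2, zero_comp]
  rw [RingHom.mem_ker]
  ext h
  exact h3 h

/-- The action of the small quotient. -/
noncomputable def thetaRR (C X : T) : A.RR C →+* AddMonoid.End (A.HM C X) :=
  (A.rho C).liftOfSurjective (A.rho_surj C) ⟨A.θ C X, A.ker_le C X⟩

noncomputable instance (C X : T) : Module (A.RR C) (A.HM C X) :=
  Module.compHom _ (A.thetaRR C X)

lemma rho_smul {C X : T} (r : R) (h : A.HM C X) : A.rho C r • h = r • h := by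
  change (A.thetaRR C X) (A.rho C r) h = A.θ C X r h
  unfold thetaRR
  rw [RingHom.liftOfRightInverse_comp_apply]

end CenterAction
end HMsec
end BIK

set_option linter.unusedSectionVars false
namespace BIK

/-- Extension of linear maps into an injective module. -/
lemma inj_extend {S : Type v} [Ring S] {E M N : Type v} [AddCommGroup E] [Module S E]
    [AddCommGroup M] [Module S M] [AddCommGroup N] [Module S N] (hE : Module.Injective S E)
    (a : M →ₗ[S] N) (b : M →ₗ[S] E) (h : ∀ m, a m = 0 → b m = 0) :
    ∃ h : N →ₗ[S] E, ∀ m, h (a m) = b m := by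
  have hle : LinearMap.ker a ≤ LinearMap.ker b := fun m hm => h m hm
  let a' : (M ⧸ LinearMap.ker a) →ₗ[S] N := (LinearMap.ker a).liftQ a le_rfl
  let b' : (M ⧸ LinearMap.ker a) →ₗ[S] E := (LinearMap.ker a).liftQ b hle
  have ha' : Function.Injective a' := by
    rw [← LinearMap.ker_eq_bot]
    exact Submodule.ker_liftQ_eq_bot _ _ _ le_rfl
  obtain ⟨g, hg⟩ := hE.out a' ha' b'
  exact ⟨g, fun m => hg (Submodule.Quotient.mk m)⟩

section HMsec

variable {R : Type u} [Ring R] {𝒜 : ℤ → AddSubgroup R} [GradedRing 𝒜]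
variable {T : Type u'} [Category.{v} T] [HasZeroObject T] [Preadditive T] [HasShift T ℤ]
  [∀ n : ℤ, (CategoryTheory.shiftFunctor T n).Additive] [Pretriangulated T]
  [HasCoproducts.{v} T]

namespace CenterAction

variable (A : CenterAction 𝒜 T)

/-- Functoriality of `HM`, additively. -/
noncomputable def mapAdd (C : T) {X Y : T} (g : X ⟶ Y) : A.HM C X →+ A.HM C Y :=
  A.hlift fun n => (A.hof n).comp (AddMonoidHom.mk' (fun f => f ≫ g⟦n⟧')
    (fun f f' => Preadditive.add_comp _ _ _ f f' _))

lemma mapAdd_hof (C : T) {X Y : T} (g : X ⟶ Y) (n : ℤ) (f : C ⟶ X⟦n⟧) :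
    A.mapAdd C g (A.hof n f) = A.hof n (f ≫ g⟦n⟧') := by
  unfold mapAdd
  rw [hlift_hof]; rfl

lemma mapAdd_smul (C : T) {X Y : T} (g : X ⟶ Y) (r : R) (h : A.HM C X) :
    A.mapAdd C g (r • h) = r • A.mapAdd C g h := by
  induction h using HM.induction with
  | h0 => rw [smul_zero, map_zero, smul_zero]
  | h2 x y hx hy => rw [smul_add, map_add, map_add, smul_add, hx, hy]
  | h1 n f =>
    induction r using DirectSum.Decomposition.inductionOn 𝒜 with
    | zero => rw [zero_smul, map_zero, zero_smul]
    | add a b ha hb => rw [add_smul, map_add, add_smul, ha, hb]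
    | @homogeneous i a =>
      rw [A.smul_hof C X a.2, mapAdd_hof, mapAdd_hof, A.smul_hof C Y a.2]
      congr 1
      unfold CenterAction.hsmul
      have h1 := A.act_natural i (a : R) a.2 (g⟦n⟧')
      have h2 := (shiftFunctorAdd' T n i (n + i) rfl).inv.naturality g
      simp only [Category.assoc]
      rw [reassoc_of% h1]
      congr 2
      exact h2.symm

/-- Functoriality of `HM`. -/
noncomputable def mapL (C : T) {X Y : T} (g : X ⟶ Y) : A.HM C X →ₗ[A.RR C] A.HM C Y where
  toFun := A.mapAdd C g
  map_add' := map_add _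
  map_smul' r h := by
    obtain ⟨r, rfl⟩ := A.rho_surj C r
    rw [rho_smul, mapAdd_smul]
    exact (rho_smul _ _ _).symm

lemma mapL_hof (C : T) {X Y : T} (g : X ⟶ Y) (n : ℤ) (f : C ⟶ X⟦n⟧) :
    A.mapL C g (A.hof n f) = A.hof n (f ≫ g⟦n⟧') := A.mapAdd_hof C g n f

lemma HM_lin_ext {C X : T} {E : Type v} [AddCommGroup E] [Module (A.RR C) E]
    {φ ψ : A.HM C X →ₗ[A.RR C] E} (h : ∀ n f, φ (A.hof n f) = ψ (A.hof n f)) : φ = ψ := by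
  refine LinearMap.ext fun x => ?_
  exact DFunLike.congr_fun (A.HM_hom_ext (φ := φ.toAddMonoidHom) (ψ := ψ.toAddMonoidHom) h) x

lemma mapL_add (C : T) {X Y : T} (g g' : X ⟶ Y) (h : A.HM C X) :
    A.mapL C (g + g') h = A.mapL C g h + A.mapL C g' h := by
  have : A.mapL C (g + g') = A.mapL C g + A.mapL C g' := by
    apply HM_lin_ext
    intro n f
    rw [LinearMap.add_apply, mapL_hof, mapL_hof, mapL_hof, Functor.map_add, Preadditive.comp_add,
      map_add]
  rw [this]; rfl

lemma mapL_comp (C : T) {X Y Z : T} (g : X ⟶ Y) (g' : Y ⟶ Z) (h : A.HM C X) :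
    A.mapL C (g ≫ g') h = A.mapL C g' (A.mapL C g h) := by
  have : A.mapL C (g ≫ g') = (A.mapL C g').comp (A.mapL C g) := by
    apply HM_lin_ext
    intro n f
    rw [LinearMap.comp_apply, mapL_hof, mapL_hof, mapL_hof, Functor.map_comp, Category.assoc]
  rw [this]; rfl

lemma mapL_id (C : T) {X : T} (h : A.HM C X) : A.mapL C (𝟙 X) h = h := by
  have : A.mapL C (𝟙 X) = LinearMap.id := by
    apply HM_lin_ext
    intro n f
    rw [mapL_hof, CategoryTheory.Functor.map_id, Category.comp_id]; rfl
  rw [this]; rfl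

lemma mapL_zero (C : T) {X Y : T} (h : A.HM C X) : A.mapL C (0 : X ⟶ Y) h = 0 := by
  have := A.mapL_add C (0 : X ⟶ Y) 0 h
  rw [add_zero] at this
  exact left_eq_add.mp this

lemma mapL_sum (C : T) {X Y : T} {J : Type*} (F : Finset J) (g : J → (X ⟶ Y)) (h : A.HM C X) :
    A.mapL C (∑ j ∈ F, g j) h = ∑ j ∈ F, A.mapL C (g j) h := by
  classical
  induction F using Finset.induction_on with
  | empty => simp [mapL_zero]
  | insert j F hj ih => rw [Finset.sum_insert hj, Finset.sum_insert hj, mapL_add, ih]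

lemma mapL_exact (C : T) (Tr : Triangle T) (hTr : Tr ∈ distTriang T) (h : A.HM C Tr.obj₂)
    (h0 : A.mapL C Tr.mor₂ h = 0) : ∃ k : A.HM C Tr.obj₁, A.mapL C Tr.mor₁ k = h := by
  have hc : ∀ (x : A.HM C Tr.obj₂) (n : ℤ),
      A.hcomp n (A.mapL C Tr.mor₂ x) = A.hcomp n x ≫ Tr.mor₂⟦n⟧' := by
    intro x n
    induction x using HM.induction with
    | h0 => simp
    | h2 x y hx hy => rw [map_add, map_add, map_add, hx, hy, Preadditive.add_comp]
    | h1 m f =>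
      rw [mapL_hof]
      by_cases hm : n = m
      · subst hm; rw [hcomp_hof, hcomp_hof]
      · rw [hcomp_hof_ne _ hm, hcomp_hof_ne _ hm, zero_comp]
  have hk : ∀ n : ℤ, ∃ g : C ⟶ Tr.obj₁⟦n⟧, A.hcomp n h = g ≫ Tr.mor₁⟦n⟧' := by
    intro n
    apply coyo2 Tr hTr n
    rw [← hc, h0, map_zero]
  choose g hg using hk
  obtain ⟨F, hF⟩ := A.hom_sum h
  refine ⟨∑ n ∈ F, A.hof n (g n), ?_⟩
  rw [map_sum]
  conv_rhs => rw [hF]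
  refine Finset.sum_congr rfl fun n _ => ?_
  rw [mapL_hof, hg]

lemma mapL_fac {C : T} (hC : IsCompactObj T C) {J : Type v} (f : J → T) (h : A.HM C (∐ f)) :
    ∃ F : Finset J, A.mapL C (eF f F) h = h := by
  classical
  induction h using HM.induction with
  | h0 => exact ⟨∅, map_zero _⟩
  | h1 n k =>
    obtain ⟨F, hF⟩ := compact_shift_fac hC f n k
    exact ⟨F, by rw [mapL_hof, hF]⟩
  | h2 x y hx hy =>
    obtain ⟨F, hF⟩ := hx
    obtain ⟨G, hG⟩ := hy
    refine ⟨F ∪ G, ?_⟩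
    rw [map_add]
    congr 1
    · rw [← hF, ← mapL_comp, eF_comp f Finset.subset_union_left]
    · rw [← hG, ← mapL_comp, eF_comp f Finset.subset_union_right]

open Classical in
lemma eF_pi {J : Type v} (f : J → T) (F : Finset J) (j : J) (hj : j ∉ F) :
    eF f F ≫ Sigma.π f j = 0 := by
  apply Sigma.hom_ext
  intro i
  rw [← Category.assoc, ι_eF]
  split_ifs with h
  · rw [Sigma.ι_π_of_ne _ (by rintro rfl; exact hj h), comp_zero]
  · rw [zero_comp, comp_zero]

open Classical in
/-- The map out of a coproduct determined by a family. -/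
noncomputable def coDesc {C : T} (hC : IsCompactObj T C) {E : Type v} [AddCommGroup E]
    [Module (A.RR C) E] {J : Type v} (f : J → T) (φ : ∀ j, A.HM C (f j) →ₗ[A.RR C] E) :
    A.HM C (∐ f) →ₗ[A.RR C] E :=
  have hfin : ∀ h : A.HM C (∐ f), (Function.support fun j => φ j (A.mapL C (Sigma.π f j) h)).Finite := by
    intro h
    obtain ⟨F, hF⟩ := A.mapL_fac hC f h
    refine F.finite_toSet.subset fun j hj => ?_
    by_contra hjF
    apply hj
    change φ j _ = 0
    rw [← hF, ← mapL_comp, eF_pi f F j hjF, mapL_zero, map_zero]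
  { toFun := fun h => ∑ᶠ j, φ j (A.mapL C (Sigma.π f j) h)
    map_add' := fun x y => by
      rw [← finsum_add_distrib (hfin x) (hfin y)]
      simp only [map_add]
    map_smul' := fun r x => by
      simp only [map_smul, RingHom.id_apply]
      exact ((DistribSMul.toAddMonoidHom E r).map_finsum (hfin x)).symm }

lemma coDesc_ι {C : T} (hC : IsCompactObj T C) {E : Type v} [AddCommGroup E]
    [Module (A.RR C) E] {J : Type v} (f : J → T) (φ : ∀ j, A.HM C (f j) →ₗ[A.RR C] E) (j : J)
    (h : A.HM C (f j)) : A.coDesc hC f φ (A.mapL C (Sigma.ι f j) h) = φ j h := by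
  classical
  change ∑ᶠ i, φ i (A.mapL C (Sigma.π f i) (A.mapL C (Sigma.ι f j) h)) = _
  rw [finsum_eq_single _ j]
  · rw [← mapL_comp, Sigma.ι_π_eq_id, mapL_id]
  · intro i hi
    rw [← mapL_comp, Sigma.ι_π_of_ne _ hi.symm, mapL_zero, map_zero]

/-- The cohomological functor attached to a compact object and an injective module. -/
noncomputable def coh {C : T} (hC : IsCompactObj T C) (E : Type v) [AddCommGroup E]
    [Module (A.RR C) E] (hE : Module.Injective (A.RR C) E) : CohFun T where
  obj X := A.HM C X →ₗ[A.RR C] E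
  grp X := inferInstance
  map g := AddMonoidHom.mk' (fun φ => φ.comp (A.mapL C g)) (fun φ ψ => LinearMap.add_comp _ _ _)
  map_id φ := by
    refine LinearMap.ext fun h => ?_
    exact congrArg φ (A.mapL_id C h)
  map_comp f g φ := by
    refine LinearMap.ext fun h => ?_
    exact congrArg φ (A.mapL_comp C f g h)
  map_add f g φ := by
    refine LinearMap.ext fun h => ?_
    exact (congrArg φ (A.mapL_add C f g h)).trans (map_add φ _ _)
  exact Tr hTr φ hφ := by
    obtain ⟨ψ, hψ⟩ := inj_extend hE (A.mapL C Tr.mor₂) φ (by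
      intro m hm
      obtain ⟨k, rfl⟩ := A.mapL_exact C Tr hTr m hm
      exact DFunLike.congr_fun hφ k)
    exact ⟨ψ, LinearMap.ext hψ⟩
  coprod f := by
    classical
    constructor
    · intro φ ψ hφψ
      refine LinearMap.ext fun h => ?_
      obtain ⟨F, hF⟩ := A.mapL_fac hC f h
      rw [← hF, eF, mapL_sum, map_sum, map_sum]
      refine Finset.sum_congr rfl fun j _ => ?_
      rw [mapL_comp]
      exact DFunLike.congr_fun (congrFun hφψ j) _
    · intro φ
      refine ⟨A.coDesc hC f φ, ?_⟩
      funext j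
      exact LinearMap.ext fun h => A.coDesc_ι hC f φ j h

/-- Representability. -/
lemma exists_repr (hgen : CompactlyGen T) {C : T} (hC : IsCompactObj T C) (E : Type v)
    [AddCommGroup E] [Module (A.RR C) E] (hE : Module.Injective (A.RR C) E) :
    ∃ (I : T) (u : A.HM C I →ₗ[A.RR C] E),
      (∀ (X : T) (φ : A.HM C X →ₗ[A.RR C] E), ∃ g : X ⟶ I, φ = u.comp (A.mapL C g)) ∧
      (∀ (X : T) (g : X ⟶ I), (∀ n f, u (A.hof n (f ≫ g⟦n⟧')) = 0) → g = 0) := by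
  obtain ⟨I, u₀, hu⟩ := (A.coh hC E hE).brown hgen
  let u : A.HM C I →ₗ[A.RR C] E := u₀
  refine ⟨I, u, fun X φ => ?_, fun X g hg => ?_⟩
  · obtain ⟨g, hg⟩ := (hu X).2 φ
    exact ⟨g, hg.symm⟩
  · apply (A.coh hC E hE).good_inj (hu X)
    apply A.HM_lin_ext
    intro n f
    have e : u (A.mapL C g (A.hof n f)) = 0 := by rw [mapL_hof]; exact hg n f
    exact e

end CenterAction
end HMsec
end BIK

set_option linter.unusedSectionVars false
namespace BIK

section ExI

variable {R : Type u} [Ring R] {𝒜 : ℤ → AddSubgroup R} [GradedRing 𝒜]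
variable {T : Type u'} [Category.{v} T] [HasZeroObject T] [Preadditive T] [HasShift T ℤ]
  [∀ n : ℤ, (CategoryTheory.shiftFunctor T n).Additive] [Pretriangulated T]
  [HasCoproducts.{v} T]

/-- Squares of homogeneous elements are central. -/
lemma sq_central (hcomm : IsGradedComm 𝒜) {i : ℤ} {a : R} (ha : a ∈ 𝒜 i) (r : R) :
    (a * a) * r = r * (a * a) := by
  induction r using DirectSum.Decomposition.inductionOn 𝒜 with
  | zero => simp
  | add b c hb hc => rw [mul_add, add_mul, hb, hc]
  | @homogeneous j b =>
    have h := hcomm i j a b ha b.2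
    rw [mul_assoc, h, mul_smul_comm, ← mul_assoc, h, smul_mul_assoc, smul_smul, mul_assoc,
      ← mul_pow, neg_one_mul, neg_neg, one_pow, one_smul]

lemma mem_of_comp {q : SpecR 𝒜} {r : R}
    (h : ∀ i, (DirectSum.decompose 𝒜 r i : R) ∈ q.1.toIdeal) : r ∈ q.1.toIdeal := by
  classical
  rw [← DirectSum.sum_support_decompose 𝒜 r]
  exact Ideal.sum_mem _ fun i _ => h i

lemma sq_cancel {q : SpecR 𝒜} {i : ℤ} {s : R} (hs : s ∈ 𝒜 i) (hsq : s ∉ q.1.toIdeal) {r : R}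
    (h : (s * s) * r ∈ q.1.toIdeal) : r ∈ q.1.toIdeal := by
  apply mem_of_comp
  intro j
  have h1 := q.1.isHomogeneous (i + i + j) h
  have h2 : (DirectSum.decompose 𝒜 (s * s * r) (i + i + j) : R)
      = s * s * (DirectSum.decompose 𝒜 r j : R) :=
    DirectSum.coe_decompose_mul_add_of_left_mem 𝒜 (SetLike.mul_mem_graded hs hs)
  rw [h2] at h1
  exact (q.2.mem_or_mem (SetLike.mul_mem_graded hs hs) (SetLike.coe_mem _) h1).resolve_left
    (CenterAction.mul_not_mem hs hs hsq hsq)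

namespace CenterAction

variable (A : CenterAction 𝒜 T)

lemma ker_rho_le {q : SpecR 𝒜} {C X : T} {n : ℤ} {f : C ⟶ X⟦n⟧} (hf : ¬ A.KillOut q f) {r : R}
    (h : r • A.hof n f = 0) : r ∈ q.1.toIdeal := by
  apply mem_of_comp
  intro i
  by_contra hi
  apply hf
  exact ⟨i, _, SetLike.coe_mem _, hi, (A.smul_hof_eq_zero (SetLike.coe_mem _)).1 (A.comp_smul_hof h i)⟩

lemma shift_act_eq {d : ℤ} {s : R} (hs : s ∈ 𝒜 d) (W : T) (n : ℤ) :
    (A.act d s hs W)⟦n⟧' = ((-1 : ℤ) ^ (d * n).natAbs) •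
      ((shiftFunctorAdd' T d (n - d) n (by ring)).hom.app W ≫
        A.act d s hs ((W⟦d⟧)⟦n - d⟧) ≫
          (shiftFunctorAdd' T (n - d) d n (by ring)).inv.app (W⟦d⟧)) := by
  have h1 := A.act_shift d s hs W n
  have h2 : (A.act d s hs W)⟦n⟧' = ((-1 : ℤ) ^ (d * n).natAbs) •
      (A.act d s hs (W⟦n⟧) ≫ (shiftComm W d n).inv) := by
    rw [h1, Preadditive.zsmul_comp, smul_smul, ← mul_pow, neg_one_mul, neg_neg, one_pow, one_smul,
      Category.assoc, Iso.hom_inv_id, Category.comp_id]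
  rw [h2]
  congr 1
  have h3 := A.act_natural d s hs ((shiftFunctorAdd' T d (n - d) n (by ring)).hom.app W)
  rw [reassoc_of% h3]
  congr 1
  have h4 := shiftFunctorAdd'_assoc_inv_app (C := T) d (n - d) d n n (n + d) (by ring) (by ring)
    (by ring) W
  rw [shiftComm, shiftFunctorComm_eq T d n (n + d) (by ring)]
  simp only [Iso.app_inv, Iso.trans_inv, Iso.symm_inv, NatTrans.comp_app]
  rw [← cancel_mono ((shiftFunctorAdd' T d n (n + d) (by ring)).inv.app W)]
  simp only [Category.assoc, Iso.hom_inv_id_app, Category.comp_id]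
  rw [← h4, ← Functor.map_comp_assoc]
  simp

/-- Uniform annihilation gives annihilation. -/
lemma pow_two {C I : T} {E : Type v} [AddCommGroup E] [Module (A.RR C) E]
    {u : A.HM C I →ₗ[A.RR C] E}
    (hu : ∀ (X : T) (g : X ⟶ I), (∀ n f, u (A.hof n (f ≫ g⟦n⟧')) = 0) → g = 0)
    {Y : T} (g : Y ⟶ I) {d : ℤ} {s : R} (hs : s ∈ 𝒜 d)
    (h : ∀ (k : ℤ) (f : C ⟶ Y⟦k⟧), A.rho C s • u (A.hof k (f ≫ g⟦k⟧')) = 0) :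
    g ≫ A.act d s hs I = 0 := by
  let W := Y⟦-d⟧
  let e : W⟦d⟧ ≅ Y := shiftNegShift Y d
  have h0 : A.act d s hs W ≫ e.hom ≫ g = 0 := by
    apply hu
    intro n f
    let f' : C ⟶ (W⟦d⟧)⟦n - d⟧ := f ≫ (shiftFunctorAdd' T d (n - d) n (by ring)).hom.app W
    have e1 : A.hof n (f ≫ (A.act d s hs W ≫ e.hom ≫ g)⟦n⟧') =
        ((-1 : ℤ) ^ (d * n).natAbs) • A.mapL C (e.hom ≫ g) (s • A.hof (n - d) f') := by
      rw [A.smul_hof _ _ hs, A.hof_hsmul hs (show n - d + d = n by ring), mapL_hof, ← map_zsmul]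
      congr 1
      rw [Functor.map_comp, A.shift_act_eq hs W n]
      simp only [f', Preadditive.zsmul_comp, Preadditive.comp_zsmul, Category.assoc]
    rw [e1, map_zsmul, ← rho_smul, map_smul, map_smul, mapL_hof, Functor.map_comp,
      ← Category.assoc, h, smul_zero]
  have h1 : (A.act d s hs W)⟦d⟧' ≫ (e.hom ≫ g)⟦d⟧' = 0 := by
    rw [← Functor.map_comp, h0, Functor.map_zero]
  have h2 : A.act d s hs (W⟦d⟧) ≫ (e.hom ≫ g)⟦d⟧' = 0 := by
    rw [act_shift_self, Preadditive.zsmul_comp, h1, smul_zero]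
  rw [← A.act_natural, Category.assoc] at h2
  exact (cancel_epi e.hom).1 (h2.trans comp_zero.symm)

lemma pow_one' (hT : NoetherianT A) {C Y : T} (hC : IsCompactObj T C) (hY : IsCompactObj T Y)
    {E : Type v} [AddCommGroup E] [Module (A.RR C) E] (φ : A.HM C Y →ₗ[A.RR C] E) {t : R}
    (ht : ∀ r, t * r = r * t) (hE : ∀ e : E, ∃ n : ℕ, (A.rho C t) ^ n • e = 0) :
    ∃ N : ℕ, ∀ (k : ℤ) (f : C ⟶ Y⟦k⟧), A.rho C (t ^ N) • φ (A.hof k f) = 0 := by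
  classical
  obtain ⟨F, hF⟩ := hT (C ⊞ Y) (compact_biprod hC hY)
  let ψ : ∀ k : ℤ, ((C ⊞ Y : T) ⟶ (C ⊞ Y : T)⟦k⟧) →+ E := fun k =>
    AddMonoidHom.mk' (fun g => φ (A.hof k (biprod.inl ≫ g ≫ (biprod.snd : C ⊞ Y ⟶ Y)⟦k⟧')))
      (fun g g' => by rw [Preadditive.add_comp, Preadditive.comp_add, map_add, map_add])
  have hψ : ∀ {i : ℤ} {a : R} (ha : a ∈ 𝒜 i) (n : ℤ) (g : (C ⊞ Y : T) ⟶ (C ⊞ Y : T)⟦n⟧),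
      ψ (n + i) (A.hsmul ha g) = A.rho C a • ψ n g := by
    intro i a ha n g
    change φ _ = A.rho C a • φ _
    rw [← map_smul, rho_smul, ← Category.assoc biprod.inl g, ← mapL_hof, ← Category.assoc, ← mapL_hof,
      ← rho_smul, ← map_smul, rho_smul, A.smul_hof _ _ ha]
    congr 3
    simp [CenterAction.hsmul]
  have hc : ∀ (N : ℕ) (a : R) (e : E), A.rho C (t ^ N) • A.rho C a • e
      = A.rho C a • A.rho C (t ^ N) • e := by
    intro N a e
    rw [smul_smul, smul_smul, ← map_mul, ← map_mul, (Commute.pow_left (ht a) N).eq]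
  have hgen : ∀ x : (n : ℤ) × ((C ⊞ Y : T) ⟶ (C ⊞ Y : T)⟦n⟧), ∃ n : ℕ,
      A.rho C (t ^ n) • ψ x.1 x.2 = 0 := by
    intro x
    obtain ⟨n, hn⟩ := hE (ψ x.1 x.2)
    exact ⟨n, by rw [map_pow]; exact hn⟩
  choose ν hν using hgen
  refine ⟨F.sup ν, ?_⟩
  set N := F.sup ν
  let Sb : HomSub A (C ⊞ Y) (C ⊞ Y) :=
    { car := fun n => ((DistribSMul.toAddMonoidHom E (A.rho C (t ^ N))).comp (ψ n)).ker
      hsmul_mem := by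
        intro i a ha n g hg
        change A.rho C (t ^ N) • ψ (n + i) (A.hsmul ha g) = 0
        have hg' : A.rho C (t ^ N) • ψ n g = 0 := hg
        rw [hψ, hc, hg', smul_zero] }
  intro k f
  have := hF Sb (by
    intro g hg
    change A.rho C (t ^ N) • ψ g.1 g.2 = 0
    obtain ⟨m, hm⟩ := Nat.exists_eq_add_of_le (Finset.le_sup (f := ν) hg)
    change N = _ at hm
    rw [hm, add_comm, pow_add, map_mul, mul_smul, hν, smul_zero]) k
    (biprod.fst ≫ f ≫ (biprod.inr : Y ⟶ C ⊞ Y)⟦k⟧')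
  have h2 : A.rho C (t ^ N) • φ (A.hof k (biprod.inl ≫ (biprod.fst ≫ f ≫
    (biprod.inr : Y ⟶ C ⊞ Y)⟦k⟧') ≫ (biprod.snd : C ⊞ Y ⟶ Y)⟦k⟧')) = 0 := this
  simp only [Category.assoc, biprod.inl_fst_assoc, ← Functor.map_comp, biprod.inr_snd,
    CategoryTheory.Functor.map_id, Category.comp_id] at h2
  exact h2

/-- Existence of the objects representing injective hulls. -/
theorem exists_I (hcomm : IsGradedComm 𝒜) (hnoeth : IsNoetherianRing R) (hgen : CompactlyGen T)
    (hT : NoetherianT A) {q : SpecR 𝒜} {C X : T} (hC : IsCompactObj T C) {n : ℤ}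
    {f : C ⟶ X⟦n⟧} (hf : ¬ A.KillOut q f) :
    ∃ I : T, (∀ W ∈ TVset T A (Zset q), ∀ g : W ⟶ I, g = 0) ∧
      (∀ (Y : T), IsCompactObj T Y → ∀ (g : Y ⟶ I) (i : ℤ) (a : R), a ∈ 𝒜 i → a ∈ q.1.toIdeal →
        ∃ (N : ℕ) (d : ℤ) (hd : a ^ N ∈ 𝒜 d), g ≫ A.act d (a ^ N) hd I = 0) ∧
      ∃ g : X ⟶ I, g ≠ 0 := by
  haveI : IsNoetherianRing (A.RR C) := isNoetherianRing_of_surjective R _ (A.rho C) (A.rho_surj C)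
  have hmem : ∀ r : R, A.rho C r ∈ q.1.toIdeal.map (A.rho C) ↔ r ∈ q.1.toIdeal := by
    intro r
    rw [Ideal.mem_map_iff_of_surjective _ (A.rho_surj C)]
    constructor
    · rintro ⟨x, hx, hxr⟩
      have h0 : A.rho C (r - x) = 0 := by rw [map_sub, hxr, sub_self]
      have h1 : r - x ∈ q.1.toIdeal := A.ker_rho_le hf (by rw [← rho_smul, h0, zero_smul])
      simpa using add_mem h1 hx
    · intro h
      exact ⟨r, h, rfl⟩
  have hcen : ∀ t : R, (∀ r, t * r = r * t) → ∀ r, A.rho C t * r = r * A.rho C t := by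
    intro t ht r
    obtain ⟨r, rfl⟩ := A.rho_surj C r
    rw [← map_mul, ← map_mul, ht]
  obtain ⟨E, iE, iM, e₀, hinj, he₀, hreg, hnil⟩ := exists_injHull (q.1.toIdeal.map (A.rho C))
  obtain ⟨I, u, hsurj, hu⟩ := A.exists_repr hgen hC E hinj
  refine ⟨I, ?_, ?_, ?_⟩
  · intro W hW g
    apply hu
    intro m k
    obtain ⟨i, s, hs, hsq, hk⟩ := mem_TZ_iff.1 ((TV_localizing A _).shift_mem W hW m) C hC k
    refine hreg (A.rho C (s * s)) (hcen _ (sq_central hcomm hs)) ?_ _ ?_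
    · intro x hx
      obtain ⟨x, rfl⟩ := A.rho_surj C x
      rw [← map_mul, hmem] at hx
      rw [hmem]
      exact sq_cancel hs hsq hx
    · rw [← mapL_hof, ← map_smul, ← map_smul, rho_smul, mul_smul, (A.smul_hof_eq_zero hs).2 hk,
        smul_zero, map_zero, map_zero]
  · intro Y hY g i a ha haq
    have hc := sq_central hcomm ha
    have haa : a * a ∈ q.1.toIdeal := Ideal.mul_mem_left _ _ haq
    obtain ⟨N, hN⟩ := A.pow_one' hT hC hY (u.comp (A.mapL C g)) hc
      (hnil _ (hcen _ hc) ((hmem _).2 haa))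
    have hd : a ^ (N + N) ∈ 𝒜 ((N + N) • i) := SetLike.pow_mem_graded _ ha
    refine ⟨N + N, _, hd, A.pow_two hu g hd fun k f => ?_⟩
    have := hN k f
    rw [LinearMap.comp_apply, mapL_hof] at this
    rw [pow_add, ← (Commute.refl a).mul_pow]
    exact this
  · obtain ⟨φ, hφ⟩ := inj_extend hinj (LinearMap.toSpanSingleton (A.RR C) _ (A.hof n f))
      (LinearMap.toSpanSingleton (A.RR C) _ e₀) (by
        intro r hr
        obtain ⟨r, rfl⟩ := A.rho_surj C r
        rw [LinearMap.toSpanSingleton_apply] at hr ⊢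
        rw [he₀, hmem]
        rw [rho_smul] at hr
        exact A.ker_rho_le hf hr)
    obtain ⟨g, hg⟩ := hsurj X φ
    refine ⟨g, ?_⟩
    rintro rfl
    have h1 := hφ 1
    rw [LinearMap.toSpanSingleton_apply, LinearMap.toSpanSingleton_apply, hg,
      LinearMap.comp_apply, mapL_zero, map_zero] at h1
    have h2 := (he₀ 1).1 h1.symm
    rw [← map_one (A.rho C), hmem] at h2
    exact one_not_mem q h2

end CenterAction
end ExI
end BIK

set_option linter.unusedSectionVars false
namespace BIK

section Final

variable {R : Type u} [Ring R] {𝒜 : ℤ → AddSubgroup R} [GradedRing 𝒜]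
variable {T : Type u'} [Category.{v} T] [HasZeroObject T] [Preadditive T] [HasShift T ℤ]
  [∀ n : ℤ, (CategoryTheory.shiftFunctor T n).Additive] [Pretriangulated T]
  [HasCoproducts.{v} T]

open CenterAction

/-- Objects which are torsion for `V(q)` and right orthogonal to the torsion objects
for `Z(q)`. -/
def GG (A : CenterAction 𝒜 T) (q : SpecR 𝒜) : Set T :=
  {I | (∀ W ∈ TVset T A (Zset q), ∀ g : W ⟶ I, g = 0) ∧ I ∈ TVset T A (Vp q)}

/-- Objects such that maps from compact objects are killed by powers of elements of `q`. -/
def PowSet (A : CenterAction 𝒜 T) (q : SpecR 𝒜) : Set T :=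
  {I | ∀ (Y : T), IsCompactObj T Y → ∀ (g : Y ⟶ I) (i : ℤ) (a : R), a ∈ 𝒜 i → a ∈ q.1.toIdeal →
        ∃ (N : ℕ) (d : ℤ) (hd : a ^ N ∈ 𝒜 d), g ≫ A.act d (a ^ N) hd I = 0}

variable {A : CenterAction 𝒜 T}

lemma PowSet_sub {q : SpecR 𝒜} {I : T} (h : I ∈ PowSet A q) : I ∈ TVset T A (Vp q) := by
  rw [mem_TV_iff]
  intro C hC p hp f
  obtain ⟨i, a, ha, haq, hap⟩ := exists_hom_not_mem (p := q) (q := p) hp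
  obtain ⟨N, d, hd, hN⟩ := h C hC f i a ha haq
  exact ⟨d, a ^ N, hd, pow_not_mem ha hap N, hN⟩

lemma PowSet_shift {q : SpecR 𝒜} {I : T} (h : I ∈ PowSet A q) (n : ℤ) : I⟦n⟧ ∈ PowSet A q := by
  intro Y hY g i a ha haq
  obtain ⟨g', rfl⟩ := exists_shift_lift n g
  obtain ⟨N, d, hd, hN⟩ := h _ (compact_shift hY (-n)) g' i a ha haq
  exact ⟨N, d, hd, A.kill_pre hd _ _ (A.kill_shift hd _ n hN)⟩

variable (B : BIKData A)

lemma Γ_zero {V : Set (SpecR 𝒜)} (hV : SpecClosed V) {X : T} (hX : IsZero X) :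
    IsZero ((B.Γ V).obj X) := by
  have hL : IsZero ((B.Lf V).obj X) := (B.kerL V hV X).2 ((TV_localizing A V).zero_mem X hX)
  have := B.tri V hV X
  have h1 : (B.γ V).app X = 0 := hX.eq_of_tgt _ _
  have h2 : (B.δ V X) = 0 := hL.eq_of_src _ _
  rw [IsZero.iff_id_eq_zero]
  obtain ⟨g, hg⟩ := coyo3 _ (rot_of_distTriang _ this) (-1)
    ((shiftFunctorCompIsoId T (1 : ℤ) (-1) (by ring)).inv.app ((B.Γ V).obj X)) (by
      change _ ≫ (-((B.γ V).app X)⟦(1 : ℤ)⟧')⟦(-1 : ℤ)⟧' = 0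
      rw [h1]; simp)
  have hg0 : (shiftFunctorCompIsoId T (1 : ℤ) (-1) (by ring)).inv.app ((B.Γ V).obj X) = 0 := by
    rw [hg]
    exact ((shiftFunctor T (-1 : ℤ)).map_isZero hL).eq_zero_of_tgt g ▸ zero_comp
  have e := (shiftFunctorCompIsoId T (1 : ℤ) (-1) (by ring)).inv_hom_id_app ((B.Γ V).obj X)
  rw [hg0, zero_comp] at e
  exact e.symm

lemma not_mem_of_supp {p : SpecR 𝒜} {X : T} (h : p ∈ B.suppObj X) : X ∉ TVset T A (Zset p) := by
  intro hX
  exact h (Γ_zero B (specClosed_V p) ((B.kerL _ (specClosed_Z p) X).2 hX))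

lemma ΓP_zero {p q : SpecR 𝒜} {X : T} (hX : X ∈ TVset T A (Vp q))
    (h : ¬ q.1.toIdeal ≤ p.1.toIdeal) : IsZero ((B.ΓP p).obj X) := by
  by_contra h'
  exact not_mem_of_supp B h' (TV_mono (V_sub_Z h) hX)

lemma exists_GG (hcomm : IsGradedComm 𝒜) (hnoeth : IsNoetherianRing R) (hgen : CompactlyGen T)
    (hT : NoetherianT A) {p q : SpecR 𝒜} {X : T} (h : p ∈ B.suppObj X)
    (hpq : p.1.toIdeal ≤ q.1.toIdeal) :
    ∃ I ∈ GG A q, I ∈ PowSet A q ∧ ∃ g : X ⟶ I, g ≠ 0 := by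
  have h1 := not_mem_of_supp B h
  rw [mem_TZ_iff] at h1
  push Not at h1
  obtain ⟨C, hC, f, hf⟩ := h1
  have hf' : ¬ A.KillOut q (f ≫ (shiftFunctorZero T ℤ).inv.app X) := by
    intro h2
    have h3 := (h2.post ((shiftFunctorZero T ℤ).hom.app X)).mono hpq
    rw [Category.assoc, Iso.inv_hom_id_app] at h3
    exact hf (by simpa using h3)
  obtain ⟨I, hI1, hI2, g, hg⟩ := A.exists_I hcomm hnoeth hgen hT hC hf'
  exact ⟨I, ⟨hI1, PowSet_sub hI2⟩, hI2, g, hg⟩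

lemma not_isZero_of_hom {X I : T} {g : X ⟶ I} (h : g ≠ 0) : ¬ IsZero I :=
  fun hI => h (hI.eq_of_tgt _ _)

lemma ΓP_mem_loc (hst : Stratified B) (p : SpecR 𝒜) (X : T) : (B.ΓP p).obj X ∈ Loc T {X} := by
  rw [hst.1 X]
  exact subset_loc _ ⟨p, rfl⟩

lemma ΓP_mem_image (p : SpecR 𝒜) (X : T) : (B.ΓP p).obj X ∈ B.ΓPImage p := ⟨X, ⟨Iso.refl _⟩⟩

lemma mem_of_ΓP (hst : Stratified B) {S : Set T} (hS : IsLocalizing T S) {X : T}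
    (h : ∀ p, (B.ΓP p).obj X ∈ S) : X ∈ S := by
  have h1 : X ∈ Loc T {X} := subset_loc _ rfl
  rw [hst.1 X] at h1
  refine loc_le hS ?_ h1
  rintro _ ⟨p, rfl⟩
  exact h p

lemma minimal_of (hst : Stratified B) {p : SpecR 𝒜} {X : T} (hX : X ∈ B.ΓPImage p)
    (h0 : ¬ IsZero X) : IsMinimalLoc (B.ΓPImage p) :=
  (hst.2 p).resolve_left fun h => h0 (h X hX)

lemma image_sub (hst : Stratified B) {p : SpecR 𝒜} {X : T} (hX : X ∈ B.ΓPImage p)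
    (h0 : ¬ IsZero X) {S : Set T} (hS : IsLocalizing T S) (hXS : X ∈ S) : B.ΓPImage p ⊆ S := by
  have hm := minimal_of B hst hX h0
  have hsub : Loc T {X} ⊆ B.ΓPImage p := loc_le hm.1 (by rintro _ rfl; exact hX)
  rcases hm.2.2 _ (loc_isLocalizing {X}) hsub with h | h
  · exact absurd (h X (subset_loc _ rfl)) h0
  · rw [← h]
    exact loc_le hS (by rintro _ rfl; exact hXS)

lemma mem_image_of (hst : Stratified B) {p : SpecR 𝒜} {I : T} (hI : ¬ IsZero I)
    (h : ∀ r, r ≠ p → IsZero ((B.ΓP r).obj I)) : I ∈ B.ΓPImage p := by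
  have hp : ¬ IsZero ((B.ΓP p).obj I) := by
    intro hp
    have hZ : IsLocalizing T {X : T | IsZero X} := by
      have hm := TV_localizing A (∅ : Set (SpecR 𝒜))
      refine ⟨fun X hX => hX, fun e hX => hX.of_iso e.symm, fun X hX n =>
        (shiftFunctor T n).map_isZero hX, fun Tr hTr h1 h2 => ?_, fun J f hf => ?_⟩
      · exact Triangle.isZero₃_of_isZero₁₂ Tr hTr h1 h2
      · rw [Set.mem_ofPred_eq, IsZero.iff_id_eq_zero]
        apply Sigma.hom_ext
        intro j
        exact (hf j).eq_of_src _ _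
    exact hI (mem_of_ΓP B hst hZ (X := I) fun r => by
      by_cases hr : r = p
      · subst hr; exact hp
      · exact h r hr)
  have hm := minimal_of B hst (ΓP_mem_image B p I) hp
  refine mem_of_ΓP B hst hm.1 fun r => ?_
  by_cases hr : r = p
  · subst hr; exact ΓP_mem_image B r I
  · exact hm.1.zero_mem _ (h r hr)

lemma claim (hcomm : IsGradedComm 𝒜) (hnoeth : IsNoetherianRing R) (hgen : CompactlyGen T)
    (hT : NoetherianT A) (hst : Stratified B) (q : SpecR 𝒜) :
    ∀ I ∈ GG A q, ∀ r, r ≠ q → IsZero ((B.ΓP r).obj I) := by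
  have wf : WellFounded fun a b : SpecR 𝒜 => b.1.toIdeal < a.1.toIdeal :=
    InvImage.wf (fun a : SpecR 𝒜 => a.1.toIdeal) (wellFounded_gt (α := Ideal R))
  induction q using wf.induction with
  | _ q ih =>
    intro I hI r hr
    by_contra h0
    by_cases hqr : q.1.toIdeal ≤ r.1.toIdeal
    · have hne : ¬ r.1.toIdeal ≤ q.1.toIdeal := by
        intro h
        apply hr
        exact Subtype.ext (HomogeneousIdeal.toIdeal_injective (le_antisymm h hqr))
      obtain ⟨I', hI', -, g, hg⟩ := exists_GG B hcomm hnoeth hgen hT (q := r)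
        (show r ∈ B.suppObj I from h0) le_rfl
      have hI'0 := not_isZero_of_hom hg
      have h1 : I' ∈ B.ΓPImage r :=
        mem_image_of B hst hI'0 (ih r (lt_of_le_not_ge hqr hne) I' hI')
      have hPI : Loc T {I} ⊆ A.PSet q :=
        loc_le (PSet_localizing A q) (by rintro _ rfl; exact perp_sub_PSet hI.1)
      have h2 : I' ∈ A.PSet q :=
        image_sub B hst (ΓP_mem_image B r I) h0 (PSet_localizing A q)
          (hPI (ΓP_mem_loc B hst r I)) h1
      exact hI'0 (PSet_inter hgen h2 (TV_mono (V_sub_Z hne) hI'.2))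
    · exact h0 (ΓP_zero B hI.2 hqr)

lemma image_props (hcomm : IsGradedComm 𝒜) (hnoeth : IsNoetherianRing R) (hgen : CompactlyGen T)
    (hT : NoetherianT A) (hst : Stratified B) (r : SpecR 𝒜) {X : T} (hX : X ∈ B.ΓPImage r) :
    X ∈ A.PSet r ∧ X ∈ TVset T A (Vp r) := by
  by_cases h0 : IsZero X
  · exact ⟨(PSet_localizing A r).zero_mem X h0, (TV_localizing A _).zero_mem X h0⟩
  · obtain ⟨Y, ⟨e⟩⟩ := id hX
    obtain ⟨I, hI, -, g, hg⟩ := exists_GG B hcomm hnoeth hgen hT (q := r)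
      (show r ∈ B.suppObj Y from fun h => h0 (h.of_iso e)) le_rfl
    have hI0 := not_isZero_of_hom hg
    have h1 : I ∈ B.ΓPImage r :=
      mem_image_of B hst hI0 (claim B hcomm hnoeth hgen hT hst r I hI)
    exact ⟨image_sub B hst h1 hI0 (PSet_localizing A r) (perp_sub_PSet hI.1) hX,
      image_sub B hst h1 hI0 (TV_localizing A _) hI.2 hX⟩

lemma act_kill_pow_add {N : ℕ} {d : ℤ} {a : R} (hd : a ^ N ∈ 𝒜 d) {D : T}
    (h : A.act (d + d) (a ^ N * a ^ N) (SetLike.mul_mem_graded hd hd) D = 0) :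
    ∃ (N : ℕ) (d : ℤ) (hd : a ^ N ∈ 𝒜 d), A.act d (a ^ N) hd D = 0 := by
  have e : a ^ N * a ^ N = a ^ (N + N) := (pow_add a N N).symm
  have hm : a ^ (N + N) ∈ 𝒜 (d + d) := e ▸ SetLike.mul_mem_graded hd hd
  refine ⟨N + N, d + d, hm, ?_⟩
  have h1 := (A.act_congr rfl e (SetLike.mul_mem_graded hd hd) hm (𝟙 D)).1 (by rw [h, comp_zero])
  rwa [Category.id_comp] at h1

lemma koszul_exists (hgen : CompactlyGen T) {p : SpecR 𝒜} {I : T} (hI : I ∈ PowSet A p)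
    (hI0 : ¬ IsZero I) (F : Finset R) (hF : ∀ a ∈ F, a ∈ p.1.toIdeal ∧ ∃ i, a ∈ 𝒜 i) :
    ∃ D : T, IsCompactObj T D ∧ (∃ (d : ℤ) (f : D ⟶ I⟦d⟧), f ≠ 0) ∧
      ∀ a ∈ F, ∃ (N : ℕ) (d : ℤ) (hd : a ^ N ∈ 𝒜 d), A.act d (a ^ N) hd D = 0 := by
  classical
  induction F using Finset.induction_on with
  | empty =>
    by_contra hcon
    apply hI0
    apply isZero_of_compact hgen
    intro C hC f
    by_contra hf
    refine hcon ⟨C, hC, ⟨0, f ≫ (shiftFunctorZero T ℤ).inv.app I, fun h => hf ?_⟩, by simp⟩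
    exact (cancel_mono _).1 (h.trans zero_comp.symm)
  | insert a F haF ih =>
    obtain ⟨D, hD, ⟨d, f, hf⟩, hk⟩ := ih fun b hb => hF b (Finset.mem_insert_of_mem hb)
    obtain ⟨hap, i, ha⟩ := hF a (Finset.mem_insert_self _ _)
    obtain ⟨N, e, he, hN⟩ := PowSet_shift hI d D hD f i a ha hap
    obtain ⟨D', w, δ, hTr⟩ := distinguished_cocone_triangle (A.act e (a ^ N) he D)
    rw [A.act_natural] at hN
    obtain ⟨f', hf'⟩ := Triangle.yoneda_exact₂ _ hTr (f⟦e⟧') hN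
    have hf'0 : f' ≠ 0 := by
      rintro rfl
      apply hf
      apply (shiftFunctor T e).map_injective
      rw [hf', Functor.map_zero]
      exact comp_zero
    refine ⟨D', compact_cone _ hTr hD (compact_shift hD e),
      ⟨d + e, f' ≫ (shiftFunctorAdd T d e).inv.app I, fun h => hf'0 ?_⟩, ?_⟩
    · exact (cancel_mono _).1 (h.trans zero_comp.symm)
    · intro b hb
      rw [Finset.mem_insert] at hb
      rcases hb with rfl | hb
      · exact act_kill_pow_add he (A.ann_koszul he w δ hTr)
      · obtain ⟨M, c, hc, hM⟩ := hk b hb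
        exact act_kill_pow_add hc (A.ann_cone _ hTr hc hc hM (A.ann_shift hc e hM))

lemma exists_gens (hnoeth : IsNoetherianRing R) (p : SpecR 𝒜) :
    ∃ F : Finset R, (∀ a ∈ F, a ∈ p.1.toIdeal ∧ ∃ i, a ∈ 𝒜 i) ∧
      ∀ r : SpecR 𝒜, (∀ a ∈ F, a ∈ r.1.toIdeal) → p.1.toIdeal ≤ r.1.toIdeal := by
  classical
  obtain ⟨G, hG⟩ := (isNoetherianRing_iff_ideal_fg R).1 hnoeth p.1.toIdeal
  refine ⟨G.biUnion fun g => (DirectSum.decompose 𝒜 g).support.image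
    fun i => (DirectSum.decompose 𝒜 g i : R), ?_, ?_⟩
  · intro a ha
    simp only [Finset.mem_biUnion, Finset.mem_image] at ha
    obtain ⟨g, hg, i, -, rfl⟩ := ha
    refine ⟨p.1.isHomogeneous i ?_, i, SetLike.coe_mem _⟩
    rw [← hG]
    exact Ideal.subset_span hg
  · intro r hr
    rw [← hG]
    refine Ideal.span_le.2 fun g hg => ?_
    change g ∈ r.1.toIdeal
    rw [← DirectSum.sum_support_decompose 𝒜 g]
    refine Ideal.sum_mem _ fun i hi => hr _ ?_
    simp only [Finset.mem_biUnion, Finset.mem_image]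
    exact ⟨g, hg, i, hi, rfl⟩

end Final
end BIK

open BIK in
/-- Corollary: the support of the left orthogonal of a localizing subcategory. -/
theorem statement_8
{R : Type u} [Ring R] (𝒜 : ℤ → AddSubgroup R) [GradedRing 𝒜]
    (hcomm : IsGradedComm 𝒜) (hnoeth : IsNoetherianRing R)
    {T : Type u'} [Category.{v} T] [HasZeroObject T] [Preadditive T] [HasShift T ℤ]
    [∀ n : ℤ, (CategoryTheory.shiftFunctor T n).Additive] [Pretriangulated T]
    [HasCoproducts.{v} T]
    (hgen : CompactlyGen T)
    (A : CenterAction 𝒜 T) (B : BIKData A)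
    (hT : NoetherianT A) (hst : Stratified B)
    (S : Set T) (hS : IsLocalizing T S) :
    B.suppSet {X : T | ∀ Y ∈ S, ∀ (n : ℤ) (f : X ⟶ Y⟦n⟧), f = 0} =
      {p | p ∈ B.suppT ∧ Vp p ∩ B.suppSet S = ∅} := by
  ext p
  constructor
  · intro hp
    simp only [BIKData.suppSet, Set.mem_iUnion] at hp
    obtain ⟨X, hX, hp⟩ := hp
    refine ⟨⟨X, hp⟩, ?_⟩
    rw [Set.eq_empty_iff_forall_notMem]
    rintro q ⟨hpq, hq⟩
    simp only [BIKData.suppSet, Set.mem_iUnion] at hq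
    obtain ⟨Y, hY, hq⟩ := hq
    obtain ⟨I, hI, -, g, hg⟩ := exists_GG B hcomm hnoeth hgen hT hp hpq
    have hI0 := not_isZero_of_hom hg
    have h1 : I ∈ B.ΓPImage q :=
      mem_image_of B hst hI0 (claim B hcomm hnoeth hgen hT hst q I hI)
    have h2 : (B.ΓP q).obj Y ∈ S :=
      loc_le hS (by rintro _ rfl; exact hY) (ΓP_mem_loc B hst q Y)
    have h3 : I ∈ S := image_sub B hst (ΓP_mem_image B q Y) hq hS h2 h1
    have h4 := hX I h3 0 (g ≫ (shiftFunctorZero T ℤ).inv.app I)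
    exact hg ((cancel_mono _).1 (h4.trans zero_comp.symm))
  · rintro ⟨⟨X, hX⟩, hdisj⟩
    obtain ⟨I, hI, hIP, g, hg⟩ := exists_GG B hcomm hnoeth hgen hT hX le_rfl
    have hI0 := not_isZero_of_hom hg
    obtain ⟨F, hF, hgens⟩ := exists_gens hnoeth p
    obtain ⟨D, hD, ⟨d, f, hf⟩, hk⟩ := koszul_exists hgen hIP hI0 F hF
    have hann : ∀ r : SpecR 𝒜, ¬ p.1.toIdeal ≤ r.1.toIdeal →
        ∃ (i : ℤ) (s : R) (hs : s ∈ 𝒜 i), s ∉ r.1.toIdeal ∧ A.act i s hs D = 0 := by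
      intro r hr
      have : ∃ a ∈ F, a ∉ r.1.toIdeal := by
        by_contra hcon
        push Not at hcon
        exact hr (hgens r hcon)
      obtain ⟨a, haF, har⟩ := this
      obtain ⟨-, i, ha⟩ := hF a haF
      obtain ⟨N, e, he, hN⟩ := hk a haF
      exact ⟨e, a ^ N, he, CenterAction.pow_not_mem ha har N, hN⟩
    have hDV : D ∈ TVset T A (Vp p) := by
      rw [CenterAction.mem_TV_iff]
      intro C hC r hr k
      obtain ⟨i, s, hs, hsr, h⟩ := hann r hr
      exact ⟨i, s, hs, hsr, by rw [h, comp_zero]⟩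
    simp only [BIKData.suppSet, Set.mem_iUnion]
    refine ⟨D, ?_, ?_⟩
    · intro Y hY
      have : Y ∈ {X : T | ∀ (n : ℤ) (f : D ⟶ X⟦n⟧), f = 0} := by
        refine mem_of_ΓP B hst (CenterAction.perp_localizing hD) fun r => ?_
        by_cases hr : p.1.toIdeal ≤ r.1.toIdeal
        · refine (CenterAction.perp_localizing hD).zero_mem _ ?_
          by_contra h0
          have hmem : r ∈ Vp p ∩ B.suppSet S :=
            ⟨hr, Set.mem_iUnion.2 ⟨Y, Set.mem_iUnion.2 ⟨hY, h0⟩⟩⟩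
          rw [hdisj] at hmem
          exact hmem
        · exact (image_props B hcomm hnoeth hgen hT hst r (ΓP_mem_image B r Y)).1 D hD (hann r hr)
      exact this
    · intro h0
      have hDZ : D ∈ TVset T A (Zset p) := by
        refine mem_of_ΓP B hst (CenterAction.TV_localizing A _) fun r => ?_
        by_cases hpr : p.1.toIdeal ≤ r.1.toIdeal
        · by_cases hrp : r.1.toIdeal ≤ p.1.toIdeal
          · have e : r = p :=
              Subtype.ext (HomogeneousIdeal.toIdeal_injective (le_antisymm hrp hpr))
            subst e
            exact (CenterAction.TV_localizing A _).zero_mem _ h0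
          · exact CenterAction.TV_mono (CenterAction.V_sub_Z hrp)
              (image_props B hcomm hnoeth hgen hT hst r (ΓP_mem_image B r D)).2
        · exact (CenterAction.TV_localizing A _).zero_mem _ (ΓP_zero B hDV hpr)
      apply hf
      obtain ⟨f', rfl⟩ := exists_shift_lift d f
      rw [hI.1 _ ((CenterAction.TV_localizing A _).shift_mem D hDZ (-d)) f', Functor.map_zero]
      exact comp_zero
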